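/- arXiv:1410.3926 — 4 statements merged into one kernel-verified Lean document; each statement's English description precedes it below -/
import Mathlib

section
/- Let t > 0 and t_0 > 2πe be real numbers. Then Σ_{ρ : ζ(ρ)=0, 0<Re ρ<1, Im ρ ≥ t+t_0} [ 1/(Im ρ − t)² + 1/(Im ρ + t)² ] ≤ (1/(2π)) ∫_{t_0}^{∞} log((x + t)/(2π)) · ( 1/x² + 1/(x + 2t)² ) dx + 4·log(t + t_0)·( 1/t_0² + 1/(t_0 + 2t)² ) + 4/(t·t_0). -/
section

open Complex Set Filter Topology MeasureTheory
open scoped Real ComplexConjugate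

/-- The error of the trapezoidal rule for `x ↦ x ^ (-s)` on `[n, n + 1]`. -/
noncomputable def trapezoidCpowError (s : ℂ) (n : ℕ) : ℂ :=
  (((n : ℂ) + 1) ^ (1 - s) - (n : ℂ) ^ (1 - s)) / (1 - s)
    - ((n : ℂ) ^ (-s) + ((n : ℂ) + 1) ^ (-s)) / 2

lemma trapezoidCpowError_eq_integral {s : ℂ} (hs : s ≠ 1) {n : ℕ} (hn : 1 ≤ n) :
    trapezoidCpowError s n =
      -(s * (s + 1) / 2) * ∫ u in (0 : ℝ)..1, (u * (1 - u) : ℂ) * (n + u : ℂ) ^ (-s - 2) := by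
  have hn0 : (0 : ℝ) < n := by exact_mod_cast hn
  have h1s : 1 - s ≠ 0 := sub_ne_zero.mpr hs.symm
  have hslit : ∀ u : ℝ, 0 ≤ u → (n + u : ℂ) ∈ slitPlane := fun u hu ↦ by
    left; simp; positivity
  have hne : ∀ u : ℝ, 0 ≤ u → (n + u : ℂ) ≠ 0 := fun u hu ↦ slitPlane_ne_zero (hslit u hu)
  have hpow : ∀ (p : ℂ) (u : ℝ), 0 ≤ u →
      HasDerivAt (fun v : ℝ ↦ (n + v : ℂ) ^ p) (p * (n + u : ℂ) ^ (p - 1)) u := by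
    intro p u hu
    have h : HasDerivAt (fun v : ℂ ↦ (n + v : ℂ) ^ p) (p * (n + u : ℂ) ^ (p - 1) * 1) (u : ℂ) :=
      ((hasDerivAt_id (u : ℂ)).const_add (n : ℂ)).cpow_const (hslit u hu)
    simpa using h.comp_ofReal
  have hofReal : ∀ u : ℝ, HasDerivAt (fun v : ℝ ↦ (v : ℂ)) 1 u := fun u ↦
    (hasDerivAt_id (u : ℂ)).comp_ofReal
  have key : ∀ u ∈ uIcc (0 : ℝ) 1, HasDerivAt
      (fun v : ℝ ↦ (v * (1 - v) : ℂ) * (-s * (n + v : ℂ) ^ (-s - 1))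
        - (1 - 2 * v) * (n + v : ℂ) ^ (-s) - 2 * ((n + v : ℂ) ^ (1 - s) / (1 - s)))
      (s * (s + 1) * ((u * (1 - u) : ℂ) * (n + u : ℂ) ^ (-s - 2))) u := by
    intro u hu
    rw [uIcc_of_le zero_le_one] at hu
    have h1 := (((hofReal u).mul ((hofReal u).const_sub 1)).mul
      ((hpow (-s - 1) u hu.1).const_mul (-s))).sub
      ((((hofReal u).const_mul 2).const_sub 1).mul (hpow (-s) u hu.1)) |>.sub
      (((hpow (1 - s) u hu.1).div_const (1 - s)).const_mul 2)
    refine h1.congr_deriv ?_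
    simp only [Pi.mul_apply]
    rw [show -s - 1 - 1 = -s - 2 by ring, show 1 - s - 1 = -s by ring]
    field_simp
    ring
  have hcont : ContinuousOn (fun u : ℝ ↦ s * (s + 1) *
      ((u * (1 - u) : ℂ) * (n + u : ℂ) ^ (-s - 2))) (uIcc 0 1) := by
    rw [uIcc_of_le zero_le_one]
    refine continuousOn_const.mul (ContinuousOn.mul (by fun_prop) ?_)
    intro u hu
    exact (hpow (-s - 2) u hu.1).continuousAt.continuousWithinAt
  have := intervalIntegral.integral_eq_sub_of_hasDerivAt key hcont.intervalIntegrable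
  rw [intervalIntegral.integral_const_mul] at this
  rw [show -(s * (s + 1) / 2) * ∫ u in (0 : ℝ)..1, (u * (1 - u) : ℂ) * (n + u : ℂ) ^ (-s - 2)
    = -(s * (s + 1) * ∫ u in (0 : ℝ)..1, (u * (1 - u) : ℂ) * (n + u : ℂ) ^ (-s - 2)) / 2 by ring,
    this, trapezoidCpowError]
  push_cast
  simp only [add_zero]
  field_simp
  ring

lemma norm_trapezoidCpowError_le {s : ℂ} (hs : s ≠ 1) (hre : -2 ≤ s.re) {n : ℕ} (hn : 1 ≤ n) :
    ‖trapezoidCpowError s n‖ ≤ ‖s‖ * ‖s + 1‖ / 12 * (n : ℝ) ^ (-s.re - 2) := by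
  have hn0 : (0 : ℝ) < n := by exact_mod_cast hn
  rw [trapezoidCpowError_eq_integral hs hn, norm_mul]
  have hint : ‖∫ u in (0 : ℝ)..1, (u * (1 - u) : ℂ) * (n + u : ℂ) ^ (-s - 2)‖ ≤
      ∫ u in (0 : ℝ)..1, u * (1 - u) * (n : ℝ) ^ (-s.re - 2) := by
    refine intervalIntegral.norm_integral_le_of_norm_le zero_le_one ?_
      (Continuous.intervalIntegrable (by fun_prop) _ _)
    refine .of_forall fun u hu ↦ ?_
    have hu0 : 0 ≤ u := hu.1.le
    have hu1 : 0 ≤ 1 - u := by linarith [hu.2]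
    rw [norm_mul, norm_mul, show (n + u : ℂ) = ((n + u : ℝ) : ℂ) by push_cast; rfl,
      norm_cpow_eq_rpow_re_of_pos (by positivity), show (1 - u : ℂ) = ((1 - u : ℝ) : ℂ) by simp,
      norm_real, norm_real, Real.norm_of_nonneg hu0, Real.norm_of_nonneg hu1]
    gcongr
    simp only [sub_re, neg_re, re_ofNat]
    exact Real.rpow_le_rpow_of_nonpos hn0 (by linarith) (by linarith)
  have hval : ∫ u in (0 : ℝ)..1, u * (1 - u) * (n : ℝ) ^ (-s.re - 2) =
      (n : ℝ) ^ (-s.re - 2) / 6 := by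
    rw [intervalIntegral.integral_mul_const]
    have : ∫ u in (0 : ℝ)..1, u * (1 - u) = 1 / 6 := by
      simp only [mul_sub, mul_one, ← pow_two]
      rw [intervalIntegral.integral_sub (by simp) (by simp)]
      simp; norm_num
    rw [this]; ring
  rw [hval] at hint
  calc _ ≤ ‖-(s * (s + 1) / 2)‖ * ((n : ℝ) ^ (-s.re - 2) / 6) := by gcongr
    _ = _ := by rw [norm_neg, norm_div, norm_mul]; norm_num; ring

/-- The Euler–Maclaurin partial sum of order one for `ζ(s)`. -/
noncomputable def zetaTrapezoidSum (s : ℂ) (N : ℕ) : ℂ :=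
  ∑ n ∈ Finset.Ico 1 N, (n : ℂ) ^ (-s) + (N : ℂ) ^ (-s) / 2 + (N : ℂ) ^ (1 - s) / (s - 1)

lemma zetaTrapezoidSum_succ {s : ℂ} (hs : s ≠ 1) {N : ℕ} (hN : 1 ≤ N) :
    zetaTrapezoidSum s (N + 1) = zetaTrapezoidSum s N - trapezoidCpowError s N := by
  have h1 : s - 1 ≠ 0 := sub_ne_zero.mpr hs
  have h2 : (1 - s)⁻¹ = -(s - 1)⁻¹ := by rw [← neg_sub s 1, inv_neg]
  rw [zetaTrapezoidSum, zetaTrapezoidSum, trapezoidCpowError, Finset.sum_Ico_succ_top hN,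
    div_eq_mul_inv _ (1 - s), h2]
  push_cast
  ring

lemma zetaTrapezoidSum_add {s : ℂ} (hs : s ≠ 1) {N : ℕ} (hN : 1 ≤ N) (K : ℕ) :
    zetaTrapezoidSum s (N + K) =
      zetaTrapezoidSum s N - ∑ k ∈ Finset.range K, trapezoidCpowError s (N + k) := by
  induction K with
  | zero => simp
  | succ K ih =>
    rw [← add_assoc, zetaTrapezoidSum_succ hs (by lia), ih, Finset.sum_range_succ]
    ring

lemma tendsto_zetaTrapezoidSum {s : ℂ} (hs : 1 < s.re) :
    Tendsto (zetaTrapezoidSum s) atTop (𝓝 (riemannZeta s)) := by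
  have hs0 : s ≠ 0 := by rintro rfl; simp at hs; linarith
  have hpow : ∀ p : ℂ, p.re < 0 → Tendsto (fun N : ℕ ↦ (N : ℂ) ^ p) atTop (𝓝 0) := by
    intro p hp
    rw [tendsto_zero_iff_norm_tendsto_zero]
    have := (tendsto_rpow_neg_atTop (neg_pos.mpr hp)).comp tendsto_natCast_atTop_atTop
    refine this.congr' ?_
    filter_upwards [eventually_gt_atTop 0] with N hN
    simp [norm_natCast_cpow_of_pos hN]
  have hsum : Tendsto (fun N : ℕ ↦ ∑ n ∈ Finset.Ico 1 N, (n : ℂ) ^ (-s)) atTop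
      (𝓝 (riemannZeta s)) := by
    have h := (Complex.summable_one_div_nat_cpow.mpr hs).hasSum.tendsto_sum_nat
    rw [← zeta_eq_tsum_one_div_nat_cpow hs] at h
    refine h.congr' ?_
    filter_upwards [eventually_gt_atTop 0] with N hN
    rw [Finset.range_eq_Ico, Finset.sum_eq_sum_Ico_succ_bot hN]
    simp [hs0, cpow_neg]
  have h := (hsum.add ((hpow (-s) (by simp only [neg_re]; linarith)).div_const 2)).add
    ((hpow (1 - s) (by simp only [sub_re, one_re]; linarith)).div_const (s - 1))
  simp only [zero_div, add_zero] at h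
  exact h.congr fun N ↦ rfl

lemma summable_add_rpow (N : ℕ) {p : ℝ} (hp : p < -1) :
    Summable fun k : ℕ ↦ ((N + k : ℕ) : ℝ) ^ p := by
  have := (Real.summable_nat_rpow.mpr hp)
  simpa [add_comm] using (summable_nat_add_iff N).mpr this

lemma summable_trapezoidCpowError {s : ℂ} (hs : s ≠ 1) (hre : -1 < s.re) {N : ℕ} (hN : 1 ≤ N) :
    Summable fun k : ℕ ↦ trapezoidCpowError s (N + k) :=
  .of_norm_bounded (g := fun k : ℕ ↦ ‖s‖ * ‖s + 1‖ / 12 * ((N + k : ℕ) : ℝ) ^ (-s.re - 2))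
    ((summable_add_rpow N (by linarith)).mul_left _)
    fun k ↦ norm_trapezoidCpowError_le hs (by linarith) (by lia)

/-- The Euler–Maclaurin formula for `ζ` in the part of the half-plane `-1 < Re s` above the
real axis. -/
lemma riemannZeta_eq_zetaTrapezoidSum_sub {s : ℂ} (hre : -1 < s.re) (him : 0 < s.im) {N : ℕ}
    (hN : 1 ≤ N) :
    riemannZeta s = zetaTrapezoidSum s N - ∑' k : ℕ, trapezoidCpowError s (N + k) := by
  set U : Set ℂ := {z | -1 < z.re} ∩ {z | 0 < z.im} with hU
  have hUo : IsOpen U := (isOpen_lt continuous_const continuous_re).inter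
    (isOpen_lt continuous_const continuous_im)
  have hUc : Convex ℝ U := (convex_halfSpace_re_gt _).inter (convex_halfSpace_im_gt _)
  have hne : ∀ z ∈ U, z ≠ 1 := by
    rintro z ⟨-, hz⟩ rfl
    simp at hz
  have hNk : ∀ k : ℕ, (((N + k : ℕ) : ℂ)) ≠ 0 := fun k ↦ by
    exact_mod_cast (by lia : N + k ≠ 0)
  have hNk1 : ∀ k : ℕ, (((N + k : ℕ) : ℂ)) + 1 ≠ 0 := fun k ↦ by
    exact_mod_cast (by lia : N + k + 1 ≠ 0)
  have hdE : ∀ (k : ℕ) (z : ℂ), z ≠ 1 →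
      DifferentiableAt ℂ (fun w ↦ trapezoidCpowError w (N + k)) z := by
    intro k z hz
    have := sub_ne_zero.mpr hz.symm
    unfold trapezoidCpowError
    have a1 := hNk k
    have a2 := hNk1 k
    refine ((((differentiableAt_id.const_sub 1).const_cpow (.inl a2)).sub
      ((differentiableAt_id.const_sub 1).const_cpow (.inl a1))).div
      (differentiableAt_id.const_sub 1) this).sub
      (((differentiableAt_id.neg.const_cpow (.inl a1)).add
      (differentiableAt_id.neg.const_cpow (.inl a2))).div_const 2)
  have hdA : DifferentiableOn ℂ (fun z ↦ zetaTrapezoidSum z N) U := by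
    intro z hz
    have hz1 := sub_ne_zero.mpr (hne z hz)
    have a1 : (N : ℂ) ≠ 0 := by simpa using hNk 0
    refine DifferentiableAt.differentiableWithinAt ?_
    unfold zetaTrapezoidSum
    refine ((DifferentiableAt.fun_sum fun n hn ↦ ?_).add
      ((differentiableAt_id.neg.const_cpow (.inl a1)).div_const 2)).add
      (((differentiableAt_id.const_sub 1).const_cpow (.inl a1)).div
        (differentiableAt_id.sub_const 1) hz1)
    have : (n : ℂ) ≠ 0 := by
      have := (Finset.mem_Ico.mp hn).1
      exact_mod_cast (by lia : n ≠ 0)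
    exact differentiableAt_id.neg.const_cpow (.inl this)
  have hdS : DifferentiableOn ℂ (fun z ↦ ∑' k : ℕ, trapezoidCpowError z (N + k)) U := by
    intro z hz
    set V : Set ℂ := {w | (z.re - 1) / 2 < w.re} ∩ {w | 0 < w.im} ∩ Metric.ball 0 (‖z‖ + 1) with hV
    have hVo : IsOpen V := ((isOpen_lt continuous_const continuous_re).inter
      (isOpen_lt continuous_const continuous_im)).inter Metric.isOpen_ball
    have hzr : -1 < z.re := hz.1
    have hzV : z ∈ V := ⟨⟨by simp; linarith, hz.2⟩, by simp⟩
    refine ((differentiableOn_tsum_of_summable_norm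
      (u := fun k ↦ (‖z‖ + 1) * (‖z‖ + 2) / 12 * ((N + k : ℕ) : ℝ) ^ (-((z.re - 1) / 2) - 2))
      ((summable_add_rpow N (by linarith)).mul_left _) (fun k w hw ↦ ?_) hVo
      (fun k w hw ↦ ?_)).differentiableAt (hVo.mem_nhds hzV)).differentiableWithinAt
    · refine (hdE k w ?_).differentiableWithinAt
      rintro rfl
      simpa using hw.1.2
    · have hw1 : w ≠ 1 := by rintro rfl; simpa using hw.1.2
      have hwr : (z.re - 1) / 2 < w.re := hw.1.1
      have hwn : ‖w‖ < ‖z‖ + 1 := by simpa using hw.2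
      refine (norm_trapezoidCpowError_le hw1 (by linarith) (by lia)).trans ?_
      have h1 : ‖w + 1‖ ≤ ‖z‖ + 2 := (norm_add_le _ _).trans (by simp; linarith)
      have h2 : (1 : ℝ) ≤ ((N + k : ℕ) : ℝ) := by exact_mod_cast (by lia : 1 ≤ N + k)
      gcongr
  have hζ : AnalyticOnNhd ℂ riemannZeta U := fun z hz ↦
    (analyticOn_riemannZeta z (hne z hz))
  have heq : ∀ z ∈ U, 1 < z.re →
      riemannZeta z = zetaTrapezoidSum z N - ∑' k : ℕ, trapezoidCpowError z (N + k) := by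
    intro z hz hz1
    refine tendsto_nhds_unique ((tendsto_add_atTop_iff_nat N).mpr (tendsto_zetaTrapezoidSum hz1)) ?_
    have := ((summable_trapezoidCpowError (hne z hz) hz.1 hN).hasSum.tendsto_sum_nat).const_sub
      (zetaTrapezoidSum z N)
    refine this.congr fun K ↦ ?_
    rw [add_comm K N, zetaTrapezoidSum_add (hne z hz) hN]
  have h2 : (2 + I : ℂ) ∈ U := by constructor <;> simp; norm_num
  refine hζ.eqOn_of_preconnected_of_eventuallyEq ((hdA.sub hdS).analyticOnNhd hUo)
    hUc.isPreconnected h2 ?_ ⟨hre, him⟩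
  have : {z : ℂ | 1 < z.re} ∩ {z | 0 < z.im} ∈ 𝓝 (2 + I : ℂ) :=
    ((isOpen_lt continuous_const continuous_re).inter
    (isOpen_lt continuous_const continuous_im)).mem_nhds (by constructor <;> simp)
  filter_upwards [this] with z hz
  exact heq z ⟨by have := hz.1; simp at this ⊢; linarith, hz.2⟩ hz.1

/-- The termwise majorant of the Euler–Maclaurin formula for `ζ`. -/
noncomputable def zetaMajorant (N : ℕ) (h C σ : ℝ) : ℝ :=
  ∑ n ∈ Finset.Ico 1 N, (n : ℝ) ^ (-σ) + (N : ℝ) ^ (-σ) / 2 + (N : ℝ) ^ (1 - σ) / h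
    + C * ∑' k : ℕ, ((N + k : ℕ) : ℝ) ^ (-σ - 2)

lemma norm_riemannZeta_le_zetaMajorant {s : ℂ} {h C : ℝ} {N : ℕ} (hre : -1 < s.re) (hh : 0 < h)
    (him : h ≤ s.im) (hC : ‖s‖ * ‖s + 1‖ / 12 ≤ C) (hN : 1 ≤ N) :
    ‖riemannZeta s‖ ≤ zetaMajorant N h C s.re := by
  have hs : s ≠ 1 := by rintro rfl; simp at him; linarith
  have hs1 : h ≤ ‖s - 1‖ := by
    have := abs_im_le_norm (s - 1)
    simp only [sub_im, one_im, sub_zero] at this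
    exact him.trans ((le_abs_self _).trans this)
  rw [riemannZeta_eq_zetaTrapezoidSum_sub hre (hh.trans_le him) hN]
  refine (norm_sub_le _ _).trans (add_le_add ?_ ?_)
  · refine (norm_add_le _ _).trans (add_le_add ((norm_add_le _ _).trans (add_le_add ?_ ?_)) ?_)
    · refine (norm_sum_le _ _).trans (Finset.sum_le_sum fun n hn ↦ ?_)
      rw [norm_natCast_cpow_of_pos (by have := (Finset.mem_Ico.mp hn).1; lia), neg_re]
    · rw [norm_div, norm_natCast_cpow_of_pos (by lia), neg_re]; simp
    · rw [norm_div, norm_natCast_cpow_of_pos (by lia), sub_re, one_re]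
      gcongr
  · have hsum := (summable_add_rpow N (p := -s.re - 2) (by linarith)).mul_left C
    rw [← tsum_mul_left]
    refine tsum_of_norm_bounded hsum.hasSum fun k ↦ ?_
    refine (norm_trapezoidCpowError_le hs (by linarith) (by lia)).trans ?_
    gcongr

lemma exp_mul_rpow_le {b σ u x : ℝ} (hx : 0 < x) (hu0 : 0 ≤ u) (hu1 : u ≤ 1)
    (hσ : σ = 5 * u - 1 / 2) :
    Real.exp (b * (σ - 2)) * x ^ (-σ) ≤ (1 - u) * (Real.exp (-(5 / 2 * b)) * x ^ (-(-1 / 2) : ℝ))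
      + u * (Real.exp (5 / 2 * b) * x ^ (-(9 / 2) : ℝ)) := by
  have hc := convexOn_exp.2 (mem_univ (-(5 / 2 * b) + Real.log x * (-(-1 / 2))))
    (mem_univ (5 / 2 * b + Real.log x * (-(9 / 2)))) (sub_nonneg.mpr hu1) hu0 (by ring)
  simp only [smul_eq_mul] at hc
  rw [Real.rpow_def_of_pos hx, Real.rpow_def_of_pos hx, Real.rpow_def_of_pos hx, ← Real.exp_add,
    ← Real.exp_add, ← Real.exp_add]
  refine (Real.exp_le_exp.mpr (le_of_eq ?_)).trans hc
  rw [hσ]; ring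

lemma exp_mul_zetaMajorant_le {N : ℕ} {h C b σ u : ℝ} (hN : 1 ≤ N) (hh : 0 < h) (hC : 0 ≤ C)
    (hu0 : 0 ≤ u) (hu1 : u ≤ 1) (hσ : σ = 5 * u - 1 / 2) :
    Real.exp (b * (σ - 2)) * zetaMajorant N h C σ ≤
      (1 - u) * (Real.exp (-(5 / 2 * b)) * zetaMajorant N h C (-1 / 2))
        + u * (Real.exp (5 / 2 * b) * zetaMajorant N h C (9 / 2)) := by
  have hN0 : (0 : ℝ) < N := by exact_mod_cast hN
  have key := fun (x : ℝ) (hx : 0 < x) ↦ exp_mul_rpow_le (b := b) hx hu0 hu1 hσ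
  have e1 := Finset.sum_le_sum fun n (hn : n ∈ Finset.Ico 1 N) ↦
    key n (by exact_mod_cast (Finset.mem_Ico.mp hn).1)
  simp only [Finset.sum_add_distrib, ← Finset.mul_sum] at e1
  have e2 := key N hN0
  have e3 : Real.exp (b * (σ - 2)) * (N : ℝ) ^ (1 - σ) ≤
      (1 - u) * (Real.exp (-(5 / 2 * b)) * (N : ℝ) ^ (1 - (-1 / 2) : ℝ))
      + u * (Real.exp (5 / 2 * b) * (N : ℝ) ^ (1 - (9 / 2) : ℝ)) := by
    have := mul_le_mul_of_nonneg_left e2 hN0.le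
    simp only [sub_eq_add_neg (1 : ℝ), Real.rpow_add hN0 1, Real.rpow_one]
    simp only [sub_eq_add_neg (1 : ℝ)] at this
    linarith
  have e4 : Real.exp (b * (σ - 2)) * ∑' k : ℕ, ((N + k : ℕ) : ℝ) ^ (-σ - 2) ≤
      (1 - u) * (Real.exp (-(5 / 2 * b)) * ∑' k : ℕ, ((N + k : ℕ) : ℝ) ^ (-(-1 / 2) - 2 : ℝ))
      + u * (Real.exp (5 / 2 * b) * ∑' k : ℕ, ((N + k : ℕ) : ℝ) ^ (-(9 / 2) - 2 : ℝ)) := by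
    have s1 := summable_add_rpow N (p := -σ - 2) (by linarith)
    have s2 := summable_add_rpow N (p := -(-1 / 2) - 2) (by norm_num)
    have s3 := summable_add_rpow N (p := -(9 / 2) - 2) (by norm_num)
    rw [← tsum_mul_left, ← tsum_mul_left, ← tsum_mul_left, ← tsum_mul_left, ← tsum_mul_left,
      ← ((s2.mul_left _).mul_left _).tsum_add ((s3.mul_left _).mul_left _)]
    refine (s1.mul_left _).tsum_le_tsum (fun k ↦ ?_)
      (((s2.mul_left _).mul_left _).add ((s3.mul_left _).mul_left _))
    have hk : (0 : ℝ) < ((N + k : ℕ) : ℝ) := by exact_mod_cast (by lia : 0 < N + k)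
    have := mul_le_mul_of_nonneg_right (key _ hk) (Real.rpow_nonneg hk.le (-2))
    have hk2 : ∀ p : ℝ, ((N + k : ℕ) : ℝ) ^ (p - 2) =
        ((N + k : ℕ) : ℝ) ^ p * ((N + k : ℕ) : ℝ) ^ (-2 : ℝ) := fun p ↦ by
      rw [sub_eq_add_neg, Real.rpow_add hk]
    rw [hk2, hk2, hk2]
    linarith
  have e3' := div_le_div_of_nonneg_right e3 hh.le
  have e4' := mul_le_mul_of_nonneg_left e4 hC
  unfold zetaMajorant
  have r1 : Real.exp (b * (σ - 2)) * (N : ℝ) ^ (1 - σ) / h =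
    Real.exp (b * (σ - 2)) * ((N : ℝ) ^ (1 - σ) / h) := by ring
  rw [r1, add_div, mul_div_assoc, mul_div_assoc, mul_div_assoc, mul_div_assoc] at e3'
  linarith

lemma sum_sqrt_le (N : ℕ) (hN : 1 ≤ N) :
    ∑ n ∈ Finset.Ico 1 N, √(n : ℝ) + √N / 2 ≤ 2 / 3 * (√N * N) := by
  induction N, hN using Nat.le_induction with
  | base => norm_num
  | succ N hN ih =>
    rw [Finset.sum_Ico_succ_top hN]
    push_cast
    have ha : √(N : ℝ) ^ 2 = N := Real.sq_sqrt (by positivity)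
    have hb : √((N : ℝ) + 1) ^ 2 = N + 1 := Real.sq_sqrt (by positivity)
    set a := √(N : ℝ)
    set b := √((N : ℝ) + 1)
    have ha0 : 0 ≤ a := Real.sqrt_nonneg _
    have hab : a ≤ b := Real.sqrt_le_sqrt (by linarith)
    rw [← ha] at ih
    rw [← hb]
    have h1 : b ^ 2 - a ^ 2 = 1 := by rw [ha, hb]; ring
    have : (a + b) / 2 = (b - a) * (a + b) ^ 2 / 2 := by
      rw [show (b - a) * (a + b) ^ 2 = (b ^ 2 - a ^ 2) * (a + b) by ring, h1]; ring
    nlinarith [mul_nonneg (sub_nonneg.mpr hab) (sq_nonneg (a - b))]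

lemma tsum_add_rpow_neg_three_halves_le (N : ℕ) (hN : 1 ≤ N) :
    ∑' k : ℕ, ((N + k : ℕ) : ℝ) ^ (-(-1 / 2) - 2 : ℝ) ≤ (√N * N)⁻¹ + 2 / √N := by
  have hpow : ∀ n : ℕ, 1 ≤ n → (n : ℝ) ^ (-(-1 / 2) - 2 : ℝ) = (√n * n)⁻¹ := by
    intro n hn
    have : (0 : ℝ) < n := by exact_mod_cast hn
    rw [show (-(-1 / 2) - 2 : ℝ) = -(1 / 2 + 1) by norm_num, Real.rpow_neg this.le,
      Real.rpow_add this, Real.rpow_one, Real.sqrt_eq_rpow]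
  have hs := summable_add_rpow N (p := -(-1 / 2) - 2) (by norm_num)
  rw [hs.tsum_eq_zero_add, add_zero, hpow N hN]
  gcongr
  have hpart : ∀ K : ℕ, ∑ k ∈ Finset.range K, ((N + (k + 1) : ℕ) : ℝ) ^ (-(-1 / 2) - 2 : ℝ)
      + 2 / √((N + K : ℕ) : ℝ) ≤ 2 / √N := by
    intro K
    induction K with
    | zero => simp
    | succ K ih =>
      rw [Finset.sum_range_succ]
      refine le_trans ?_ ih
      rw [add_assoc, hpow _ (by lia), ← add_assoc N K 1]
      generalize hm : N + K = m
      gcongr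
      have hm0 : (0 : ℝ) < m := by exact_mod_cast (by lia : 0 < m)
      push_cast
      have ha : √(m : ℝ) ^ 2 = m := Real.sq_sqrt (by positivity)
      have hb : √((m : ℝ) + 1) ^ 2 = m + 1 := Real.sq_sqrt (by positivity)
      have ha0 : 0 < √(m : ℝ) := Real.sqrt_pos.mpr hm0
      have hab : √(m : ℝ) ≤ √((m : ℝ) + 1) := Real.sqrt_le_sqrt (by linarith)
      set a := √(m : ℝ)
      set b := √((m : ℝ) + 1)
      rw [← hb]
      have hb0 : 0 < b := ha0.trans_le hab
      have h1 : (b - a) * (a + b) = 1 := by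
        rw [show (b - a) * (a + b) = b ^ 2 - a ^ 2 by ring, ha, hb]; ring
      have h2 : b - a = 1 / (a + b) := by field_simp; linarith
      have h3 : 2 / a = 2 / b + 2 * (b - a) / (a * b) := by field_simp; ring
      rw [h3, h2, add_comm]
      gcongr
      rw [inv_eq_one_div, div_le_div_iff₀ (by positivity) (by positivity)]
      have : b * b ^ 2 * (2 * (1 / (a + b))) = 2 * b ^ 3 / (a + b) := by ring
      rw [mul_comm _ (b * b ^ 2), this, le_div_iff₀ (by positivity)]
      nlinarith [mul_pos ha0 hb0, mul_nonneg hb0.le (mul_nonneg (sub_nonneg.mpr hab) hb0.le),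
        mul_nonneg hb0.le (mul_nonneg (sub_nonneg.mpr hab) ha0.le)]
  refine Real.tsum_le_of_sum_range_le (fun k ↦ by positivity) fun K ↦ ?_
  have := hpart K
  have h0 : 0 ≤ 2 / √((N + K : ℕ) : ℝ) := by positivity
  linarith

lemma sum_rpow_neg_nine_halves_le {N : ℕ} (hN : 1 ≤ N) :
    ∑ n ∈ Finset.Ico 1 N, (n : ℝ) ^ (-(9 / 2) : ℝ) + (N : ℝ) ^ (-(9 / 2) : ℝ) / 2 ≤ 1.0824 := by
  have h4 : ∀ n : ℕ, 1 ≤ n → (n : ℝ) ^ (-(9 / 2) : ℝ) ≤ 1 / (n : ℝ) ^ 4 := by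
    intro n hn
    have : (1 : ℝ) ≤ n := by exact_mod_cast hn
    rw [one_div, ← Real.rpow_natCast, ← Real.rpow_neg (by linarith)]
    exact Real.rpow_le_rpow_of_exponent_le this (by norm_num)
  have hN0 : 0 ≤ (N : ℝ) ^ (-(9 / 2) : ℝ) := by positivity
  calc _ ≤ ∑ n ∈ Finset.Ico 1 N, (n : ℝ) ^ (-(9 / 2) : ℝ) + (N : ℝ) ^ (-(9 / 2) : ℝ) := by linarith
    _ = ∑ n ∈ Finset.Ico 1 (N + 1), (n : ℝ) ^ (-(9 / 2) : ℝ) := by rw [Finset.sum_Ico_succ_top hN]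
    _ ≤ ∑ n ∈ Finset.Ico 1 (N + 1), 1 / (n : ℝ) ^ 4 :=
      Finset.sum_le_sum fun n hn ↦ h4 n (Finset.mem_Ico.mp hn).1
    _ ≤ ∑' n : ℕ, 1 / (n : ℝ) ^ 4 :=
      hasSum_zeta_four.summable.sum_le_tsum _ fun n _ ↦ by positivity
    _ = π ^ 4 / 90 := hasSum_zeta_four.tsum_eq
    _ ≤ 3.1416 ^ 4 / 90 := by gcongr; exact Real.pi_lt_d4.le
    _ ≤ 1.0824 := by norm_num

lemma zetaMajorant_neg_half_le {T : ℝ} (hT : 17 ≤ T) {N : ℕ} (hN : T / 3 ≤ N)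
    (hN' : (N : ℝ) ≤ T / 3 + 1) :
    zetaMajorant N (T - 5 / 2) (0.112 * T ^ 2) (-1 / 2) ≤ 0.61 * (√T * T) := by
  have hN0 : (0 : ℝ) < N := by linarith
  have hN1 : 1 ≤ N := by exact_mod_cast hN0
  have e1 := sum_sqrt_le N hN1
  have e2 := tsum_add_rpow_neg_three_halves_le N hN1
  have hhalf : ∀ n : ℕ, (n : ℝ) ^ (-(-1 / 2) : ℝ) = √n := fun n ↦ by
    rw [Real.sqrt_eq_rpow]; norm_num
  have h32 : (N : ℝ) ^ (1 - (-1 / 2) : ℝ) = √N * N := by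
    rw [show (1 - (-1 / 2) : ℝ) = 1 / 2 + 1 by norm_num, Real.rpow_add hN0, Real.rpow_one,
      Real.sqrt_eq_rpow]
  unfold zetaMajorant
  simp only [hhalf, h32]
  have hsT : 0 < √T := Real.sqrt_pos.mpr (by linarith)
  have hT2 : √T ^ 2 = T := Real.sq_sqrt (by linarith)
  have hup : √(N : ℝ) ≤ 0.6263 * √T := by
    rw [show (0.6263 : ℝ) = √(0.6263 ^ 2) by rw [Real.sqrt_sq (by norm_num)],
      ← Real.sqrt_mul (by positivity)]
    exact Real.sqrt_le_sqrt (by linarith)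
  have hNT : (N : ℝ) ≤ 0.3922 * T := by linarith
  have h1 : √(N : ℝ) * N ≤ 0.2457 * (√T * T) := by
    calc _ ≤ (0.6263 * √T) * (0.3922 * T) := by gcongr
      _ ≤ _ := by nlinarith [mul_pos hsT (by linarith : 0 < T)]
  have h2 : √(N : ℝ) * N / (T - 5 / 2) ≤ 0.0690 * (√(N : ℝ) * N) := by
    rw [div_le_iff₀ (by linarith)]
    have : 0 ≤ √(N : ℝ) * N := by positivity
    nlinarith
  have hlow : 0.5773 * √T ≤ √(N : ℝ) := by
    rw [show (0.5773 : ℝ) = √(0.5773 ^ 2) by rw [Real.sqrt_sq (by norm_num)],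
      ← Real.sqrt_mul (by positivity)]
    exact Real.sqrt_le_sqrt (by norm_num; linarith)
  have h3 : (√(N : ℝ) * N)⁻¹ + 2 / √N ≤ (0.5773 * √T * (T / 3))⁻¹ + 2 / (0.5773 * √T) := by
    gcongr
  have h4 : 0.112 * T ^ 2 * ((0.5773 * √T * (T / 3))⁻¹ + 2 / (0.5773 * √T)) ≤
      0.423 * (√T * T) := by
    rw [show 0.112 * T ^ 2 * ((0.5773 * √T * (T / 3))⁻¹ + 2 / (0.5773 * √T)) =
      0.112 * (T * (3 + 2 * T)) / (0.5773 * √T) by field_simp, div_le_iff₀ (by positivity)]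
    have : 0.423 * (√T * T) * (0.5773 * √T) = 0.423 * 0.5773 * T * T := by
      rw [← hT2]; rw [hT2]; linear_combination 0.423 * 0.5773 * T * hT2
    rw [this]
    nlinarith
  have h5 := (mul_le_mul_of_nonneg_left (e2.trans h3)
    (by positivity : 0 ≤ 0.112 * T ^ 2)).trans h4
  have h6 : 0 < √T * T := by positivity
  linarith

lemma zetaMajorant_nine_halves_le {T : ℝ} (hT : 17 ≤ T) {N : ℕ} (hN : T / 3 ≤ N) :
    zetaMajorant N (T - 5 / 2) (0.112 * T ^ 2) (9 / 2) ≤ 1.1 := by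
  have hN0 : (0 : ℝ) < N := by linarith
  have hN1 : 1 ≤ N := by exact_mod_cast hN0
  have hN6 : 6 ≤ N := by
    have : (5 : ℝ) < N := by linarith
    exact_mod_cast this
  have hN6' : (6 : ℝ) ≤ N := by exact_mod_cast hN6
  have e1 := sum_rpow_neg_nine_halves_le hN1
  have e2 : (N : ℝ) ^ (1 - 9 / 2 : ℝ) / (T - 5 / 2) ≤ 0.0004 := by
    calc _ ≤ (N : ℝ) ^ (-3 : ℝ) / (17 - 5 / 2) := by
          gcongr
          · linarith
          · norm_num
      _ ≤ (6 : ℝ) ^ (-3 : ℝ) / (17 - 5 / 2) := by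
          gcongr 1
          exact Real.rpow_le_rpow_of_nonpos (by norm_num) hN6' (by norm_num)
      _ ≤ _ := by
          rw [Real.rpow_neg (by norm_num)]; norm_num
  have e3 : 0.112 * T ^ 2 * ∑' k : ℕ, ((N + k : ℕ) : ℝ) ^ (-(9 / 2) - 2 : ℝ) ≤ 0.011 := by
    have hs1 := summable_add_rpow N (p := -(9 / 2) - 2) (by norm_num)
    have hs2 := summable_add_rpow N (p := -(-1 / 2) - 2) (by norm_num)
    have : ∑' k : ℕ, ((N + k : ℕ) : ℝ) ^ (-(9 / 2) - 2 : ℝ) ≤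
        ∑' k : ℕ, (N : ℝ) ^ (-5 : ℝ) * ((N + k : ℕ) : ℝ) ^ (-(-1 / 2) - 2 : ℝ) := by
      refine hs1.tsum_le_tsum (fun k ↦ ?_) (hs2.mul_left _)
      have hk : (N : ℝ) ≤ ((N + k : ℕ) : ℝ) := by exact_mod_cast (by lia : N ≤ N + k)
      rw [show (-(9 / 2) - 2 : ℝ) = -5 + (-(-1 / 2) - 2) by norm_num,
        Real.rpow_add (hN0.trans_le hk)]
      gcongr ?_ * _
      exact Real.rpow_le_rpow_of_nonpos hN0 hk (by norm_num)
    rw [tsum_mul_left] at this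
    have h2 := tsum_add_rpow_neg_three_halves_le N hN1
    have hs6 : 2 ≤ √(N : ℝ) := Real.le_sqrt_of_sq_le (by linarith)
    have h3 : (√(N : ℝ) * N)⁻¹ + 2 / √N ≤ (2 * 6)⁻¹ + 2 / 2 := by gcongr
    have h5 : (N : ℝ) ^ (-5 : ℝ) = ((N : ℝ) ^ 5)⁻¹ := by
      rw [Real.rpow_neg hN0.le]; norm_cast
    calc _ ≤ 0.112 * (3 * N) ^ 2 * (((N : ℝ) ^ 5)⁻¹ * ((2 * 6)⁻¹ + 2 / 2)) := by
          rw [← h5]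
          have h0 : 0 ≤ ∑' k : ℕ, ((N + k : ℕ) : ℝ) ^ (-(9 / 2) - 2 : ℝ) :=
            tsum_nonneg fun k ↦ by positivity
          gcongr
          · linarith
          · exact this.trans (by gcongr; exact h2.trans h3)
      _ = 0.112 * 9 * ((2 * 6)⁻¹ + 2 / 2) / (N : ℝ) ^ 3 := by field_simp; norm_num
      _ ≤ 0.112 * 9 * ((2 * 6)⁻¹ + 2 / 2) / 6 ^ 3 := by gcongr
      _ ≤ _ := by norm_num
  unfold zetaMajorant
  linarith

lemma card_zeros_le_of_norm_le {c : ℂ} {r R M : ℝ} {f : ℂ → ℂ} (hr : 0 < r) (hrR : r < R)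
    (hM : 1 ≤ M) (hf : AnalyticOnNhd ℂ f (Metric.closedBall c R)) (hfc : f c ≠ 0)
    (hb : ∀ z ∈ Metric.closedBall c R, ‖f z‖ ≤ M) {Z : Finset ℂ}
    (hZ : ∀ z ∈ Z, z ∈ Metric.closedBall c r ∧ f z = 0) :
    (Z.card : ℝ) ≤ Real.log (M / ‖f c‖) / Real.log (R / r) := by
  have hR := hr.trans hrR
  have hsub : Metric.closedBall c r ⊆ Metric.closedBall c R := Metric.closedBall_subset_closedBall hrR.le
  have hfr := hf.mono hsub
  have h := AnalyticOnNhd.sum_divisor_le (c := c) (r := r) (R := R) (M := M) (f := f)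
    (by rwa [abs_of_pos hr]) (by rwa [abs_of_pos hr, abs_of_pos hR]) hM
    (by rwa [abs_of_pos hR]) hfc
    (by rw [abs_of_pos hR]; exact fun z hz ↦ hb z (Metric.sphere_subset_closedBall hz))
  rw [abs_of_pos hr] at h
  refine le_trans ?_ h
  have hfin := (MeromorphicOn.divisor f (Metric.closedBall c r)).finiteSupport
    (isCompact_closedBall c r)
  have hpos : ∀ z ∈ Z, 1 ≤ MeromorphicOn.divisor f (Metric.closedBall c r) z := by
    intro z hz
    obtain ⟨hzb, hz0⟩ := hZ z hz
    rw [MeromorphicOn.divisor_apply hfr.meromorphicOn hzb]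
    have h1 : 0 < meromorphicOrderAt f z := by
      rw [← tendsto_zero_iff_meromorphicOrderAt_pos (hfr z hzb).meromorphicAt]
      have := (hfr z hzb).continuousAt.tendsto
      rw [hz0] at this
      exact this.mono_left nhdsWithin_le_nhds
    have hc : c ∈ Metric.closedBall c r := Metric.mem_closedBall_self hr.le
    have h2 : meromorphicOrderAt f z ≠ ⊤ := by
      refine hfr.meromorphicOn.meromorphicOrderAt_ne_top_of_isPreconnected
        (convex_closedBall c r).isPreconnected hc hzb ?_
      have : meromorphicOrderAt f c = 0 := by
        rw [(hfr c hc).meromorphicOrderAt_eq, (hfr c hc).analyticOrderAt_eq_zero.mpr hfc]; rfl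
      rw [this]; exact WithTop.zero_ne_top
    lift meromorphicOrderAt f z to ℤ using h2 with m hm
    have : 0 < m := by exact_mod_cast h1
    exact this
  have hnn := MeromorphicOn.AnalyticOnNhd.divisor_nonneg hfr
  have key : (Z.card : ℤ) ≤ ∑ᶠ u, MeromorphicOn.divisor f (Metric.closedBall c r) u := by
    rw [finsum_eq_sum_of_support_subset (s := hfin.toFinset ∪ Z) _
      (by simp)]
    calc (Z.card : ℤ) = ∑ z ∈ Z, 1 := by simp
      _ ≤ ∑ z ∈ Z, MeromorphicOn.divisor f (Metric.closedBall c r) z := Finset.sum_le_sum hpos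
      _ ≤ _ := Finset.sum_le_sum_of_subset_of_nonneg Finset.subset_union_right
        fun z _ _ ↦ hnn z
  exact_mod_cast key

lemma exp_mul_norm_riemannZeta_le {T : ℝ} (hT : 17 ≤ T) : ∃ b : ℝ,
    ∀ s ∈ Metric.closedBall (2 + T * I : ℂ) (5 / 2),
      Real.exp (b * (s.re - 2)) * ‖riemannZeta s‖ ≤ √(0.671 * (√T * T)) := by
  have hsT : 0 < √T := Real.sqrt_pos.mpr (by linarith)
  have hX : 0 < √T * T := by positivity
  set L : ℝ := 0.61 * (√T * T) with hL
  have hL0 : 0 < L := by positivity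
  refine ⟨Real.log (L / 1.1) / 5, fun s hs ↦ ?_⟩
  have hs' : ‖s - (2 + T * I)‖ ≤ 5 / 2 := by simpa [dist_eq_norm] using hs
  have hre := (abs_le.mp ((abs_re_le_norm _).trans hs'))
  have him := (abs_le.mp ((abs_im_le_norm _).trans hs'))
  simp at hre him
  obtain ⟨N, hN⟩ : ∃ N : ℕ, N = ⌈T / 3⌉₊ := ⟨_, rfl⟩
  have hN1 : T / 3 ≤ N := hN ▸ Nat.le_ceil _
  have hN2 : (N : ℝ) ≤ T / 3 + 1 := hN ▸ (Nat.ceil_lt_add_one (by linarith)).le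
  have hNpos : 1 ≤ N := by
    have : (0 : ℝ) < N := by linarith
    exact_mod_cast this
  have hnorm : ∀ a : ℝ, 0 ≤ a → ‖(a + T * I : ℂ)‖ ≤ T + a ^ 2 / 34 := by
    intro a ha
    rw [norm_def, normSq_add_mul_I]
    refine Real.sqrt_le_iff.mpr ⟨by positivity, ?_⟩
    nlinarith [sq_nonneg (a ^ 2), mul_nonneg (sub_nonneg.mpr hT) (sq_nonneg a)]
  have hn1 : ‖s‖ ≤ T + 2.62 := by
    have := norm_add_le (s - (2 + T * I)) ((2 : ℝ) + T * I)
    have h2 := hnorm 2 (by norm_num)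
    push_cast at this h2
    rw [sub_add_cancel] at this
    norm_num at h2 ⊢
    linarith
  have hn2 : ‖s + 1‖ ≤ T + 2.77 := by
    have := norm_add_le (s - (2 + T * I)) ((3 : ℝ) + T * I)
    have h2 := hnorm 3 (by norm_num)
    push_cast at this h2
    rw [show s - (2 + T * I) + (3 + T * I) = s + 1 by ring] at this
    norm_num at h2 ⊢
    linarith
  have hC : ‖s‖ * ‖s + 1‖ / 12 ≤ 0.112 * T ^ 2 := by
    have : ‖s‖ * ‖s + 1‖ ≤ (T + 2.62) * (T + 2.77) := by gcongr
    nlinarith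
  have hz := norm_riemannZeta_le_zetaMajorant (s := s) (h := T - 5 / 2) (by linarith) (by linarith)
    (by linarith) hC hNpos
  set u : ℝ := (s.re + 1 / 2) / 5 with hu
  have hu0 : 0 ≤ u := by rw [hu]; apply div_nonneg <;> linarith
  have hu1 : u ≤ 1 := by rw [hu, div_le_one (by norm_num)]; linarith
  have h1 := exp_mul_zetaMajorant_le (N := N) (h := T - 5 / 2) (C := 0.112 * T ^ 2)
    (b := Real.log (L / 1.1) / 5) (σ := s.re) hNpos (by linarith) (by positivity) hu0 hu1
    (by rw [hu]; ring)
  have hexp : Real.exp (5 / 2 * (Real.log (L / 1.1) / 5)) = √(L / 1.1) := by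
    rw [Real.sqrt_eq_rpow, Real.rpow_def_of_pos (by positivity)]
    congr 1; ring
  rw [Real.exp_neg, hexp] at h1
  have hq : 0 < √(L / 1.1) := Real.sqrt_pos.mpr (by positivity)
  have hprod : √(0.671 * (√T * T)) = √(L / 1.1) * 1.1 := by
    rw [show (0.671 * (√T * T)) = L / 1.1 * 1.1 ^ 2 by rw [hL]; ring,
      Real.sqrt_mul (by positivity), Real.sqrt_sq (by norm_num)]
  have hprod' : (√(L / 1.1))⁻¹ * L = √(L / 1.1) * 1.1 := by
    have := Real.mul_self_sqrt (by positivity : 0 ≤ L / 1.1)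
    rw [inv_mul_eq_iff_eq_mul₀ hq.ne', ← mul_assoc, this]
    ring
  calc _ ≤ Real.exp (Real.log (L / 1.1) / 5 * (s.re - 2)) *
        zetaMajorant N (T - 5 / 2) (0.112 * T ^ 2) s.re := by gcongr
    _ ≤ _ := h1
    _ ≤ (1 - u) * ((√(L / 1.1))⁻¹ * L) + u * (√(L / 1.1) * 1.1) := by
      have := sub_nonneg.mpr hu1
      gcongr
      · exact zetaMajorant_neg_half_le hT hN1 hN2
      · exact zetaMajorant_nine_halves_le hT hN1
    _ = _ := by rw [hprod', hprod]; ring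

lemma re_riemannZeta_two_add_ge {y : ℝ} : 0.355 ≤ (riemannZeta (2 + y * I)).re := by
  have h2 : (2 + y * I : ℂ).re = 2 := by simp
  have hs := (Complex.summable_one_div_nat_cpow (p := 2 + y * I)).mpr (by rw [h2]; norm_num)
  rw [zeta_eq_tsum_one_div_nat_add_one_cpow (by rw [h2]; norm_num)]
  have hs' : Summable fun n : ℕ ↦ 1 / ((n : ℂ) + 1) ^ (2 + y * I : ℂ) := by
    simpa using (summable_nat_add_iff 1).mpr hs
  rw [hs'.tsum_eq_zero_add]
  have hz : HasSum (fun n : ℕ ↦ 1 / ((n : ℝ) + 1 + 1) ^ 2) (π ^ 2 / 6 - 1) := by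
    have h := hasSum_zeta_two
    rw [← hasSum_nat_add_iff' 2] at h
    simpa [Finset.sum_range_succ, add_assoc, one_add_one_eq_two] using h
  have hb : ‖∑' n : ℕ, 1 / (((n + 1 : ℕ) : ℂ) + 1) ^ (2 + y * I : ℂ)‖ ≤ π ^ 2 / 6 - 1 := by
    refine tsum_of_norm_bounded hz fun n ↦ ?_
    rw [norm_div, norm_one, show (((n + 1 : ℕ) : ℂ) + 1) = ((n + 1 + 1 : ℕ) : ℂ) by push_cast; ring,
      norm_natCast_cpow_of_pos (by lia), h2]
    push_cast
    norm_cast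
  have hb' := (abs_le.mp ((abs_re_le_norm _).trans hb)).1
  have hpi : π ^ 2 ≤ 3.1416 ^ 2 := by gcongr; exact Real.pi_lt_d4.le
  simp only [add_re]
  have : ((1 : ℂ) / (((0 : ℕ) : ℂ) + 1) ^ (2 + y * I : ℂ)).re = 1 := by simp
  rw [this]
  linarith

/-- Jensen's formula bounds the number of zeros of `x ↦ Re ζ(x + iT)` on `[1/2, 2]`. -/
lemma card_re_riemannZeta_zeros_le {T : ℝ} (hT : 17 ≤ T) {Z : Finset ℝ}
    (hZ : ∀ x ∈ Z, 1 / 2 ≤ x ∧ x ≤ 2 ∧ (riemannZeta (x + T * I)).re = 0) :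
    (Z.card : ℝ) ≤ 1.5 * Real.log T + 1.6 := by
  obtain ⟨b, hb⟩ := exp_mul_norm_riemannZeta_le hT
  set M : ℝ := √(0.671 * (√T * T)) with hM
  set f : ℂ → ℂ := fun z ↦ exp (b * (z - 2)) *
    ((riemannZeta (z + T * I) + riemannZeta (z - T * I)) / 2) with hf
  have hconj : ∀ z : ℂ, riemannZeta (z - T * I) = conj (riemannZeta (conj z + T * I)) := by
    intro z
    rw [← riemannZeta_conj]
    simp [sub_eq_add_neg]
  have hreal : ∀ x : ℝ, f x = Real.exp (b * (x - 2)) * (riemannZeta (x + T * I)).re := by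
    intro x
    rw [hf]
    simp only [hconj, conj_ofReal, add_conj]
    push_cast
    ring
  have him : ∀ z ∈ Metric.closedBall (2 : ℂ) (5 / 2), |z.im| ≤ 5 / 2 := by
    intro z hz
    have := (abs_im_le_norm (z - 2)).trans (by simpa [dist_eq_norm] using hz)
    simpa using this
  have han : AnalyticOnNhd ℂ f (Metric.closedBall 2 (5 / 2)) := by
    intro z hz
    have h := abs_le.mp (him z hz)
    have n1 : z + T * I ≠ 1 := by
      intro h1
      have := congrArg im h1
      simp at this
      linarith
    have n2 : z - T * I ≠ 1 := by
      intro h1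
      have := congrArg im h1
      simp at this
      linarith
    have a1 := (analyticOn_riemannZeta _ n1).comp_of_eq
      (f := fun z : ℂ ↦ z + T * I) (x := z) (analyticAt_id.add analyticAt_const) rfl
    have a2 := (analyticOn_riemannZeta _ n2).comp_of_eq
      (f := fun z : ℂ ↦ z - T * I) (x := z) (analyticAt_id.sub analyticAt_const) rfl
    exact AnalyticAt.mul (by fun_prop) ((a1.add a2).div analyticAt_const (by norm_num))
  have hbd : ∀ z ∈ Metric.closedBall (2 : ℂ) (5 / 2), ‖f z‖ ≤ M := by
    intro z hz
    have hz' : ‖z - 2‖ ≤ 5 / 2 := by simpa [dist_eq_norm] using hz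
    have m1 := hb (z + T * I) (by
      rwa [mem_closedBall_iff_norm, show z + T * I - (2 + T * I) = z - 2 by ring])
    have m2 := hb (conj z + T * I) (by
      rwa [mem_closedBall_iff_norm, show conj z + T * I - (2 + T * I) = conj (z - 2) by
        rw [map_sub, map_ofNat]; ring, norm_conj])
    simp only [add_re, mul_re, ofReal_re, I_re, ofReal_im, I_im, conj_re] at m1 m2
    rw [hf, norm_mul, norm_exp, norm_div, hconj]
    have h3 := norm_add_le (riemannZeta (z + T * I)) (conj (riemannZeta (conj z + T * I)))
    rw [norm_conj] at h3
    have hre : (b * (z - 2) : ℂ).re = b * (z.re - 2) := by simp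
    have h4 := mul_le_mul_of_nonneg_left h3 (Real.exp_pos (b * (z.re - 2))).le
    rw [hre, norm_ofNat]
    norm_num at m1 m2
    linarith
  have hX : 17 ≤ √T * T := by
    have : 1 ≤ √T := Real.one_le_sqrt.mpr (by linarith)
    nlinarith
  have h2 : f ((2 : ℝ) : ℂ) = (riemannZeta (2 + T * I)).re := by rw [hreal]; simp
  have hge := re_riemannZeta_two_add_ge (y := T)
  have hne : f 2 ≠ 0 := by
    push_cast at h2
    rw [h2, ofReal_ne_zero]
    linarith
  have hcard := card_zeros_le_of_norm_le (c := 2) (r := 3 / 2) (R := 5 / 2)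
    (Z := Z.map ⟨ofReal, ofReal_injective⟩) (by norm_num) (by norm_num)
    (Real.one_le_sqrt.mpr (by linarith)) han hne hbd (by
      intro z hz
      obtain ⟨x, hx, rfl⟩ := Finset.mem_map.mp hz
      obtain ⟨h1, h2, h3⟩ := hZ x hx
      simp only [Function.Embedding.coeFn_mk]
      refine ⟨?_, ?_⟩
      · rw [mem_closedBall_iff_norm, show (x - 2 : ℂ) = ((x - 2 : ℝ) : ℂ) by push_cast; rfl,
          norm_real, Real.norm_eq_abs, abs_le]
        constructor <;> linarith
      · rw [hreal, h3, ofReal_zero, mul_zero])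
  rw [Finset.card_map, ← hM] at hcard
  refine hcard.trans ?_
  have hf2 : 0.355 ≤ ‖f 2‖ := by
    push_cast at h2
    rw [h2, norm_real]
    exact hge.trans (le_abs_self _)
  have hM0 : 0 < M := Real.sqrt_pos.mpr (by linarith)
  have hT0 : 0 < T := by linarith
  have hlogT : Real.log 17 ≤ Real.log T := Real.log_le_log (by norm_num) hT
  have hl17 : 2.8 ≤ Real.log 17 := by
    have h1 := Real.one_sub_inv_le_log_of_pos (x := 17 / 16) (by norm_num)
    have h2 := Real.log_two_gt_d9
    rw [show (17 : ℝ) = 2 ^ 4 * (17 / 16) by norm_num, Real.log_mul (by norm_num) (by norm_num),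
      Real.log_pow]
    norm_num at h1 h2 ⊢
    linarith
  have hl53 : 0.51 ≤ Real.log (5 / 2 / (3 / 2)) := by
    have := Real.sum_range_le_log_div (x := 1 / 4) (by norm_num) (by norm_num) 2
    norm_num [Finset.sum_range_succ] at this ⊢
    linarith
  have hnum : Real.log (M / ‖f 2‖) ≤ 3 / 4 * Real.log T + 0.84 := by
    have hlog : Real.log (√T * T) = 3 / 2 * Real.log T := by
      rw [Real.log_mul (Real.sqrt_pos.mpr hT0).ne' hT0.ne', Real.log_sqrt hT0.le]; ring
    have h1 : Real.log (M / ‖f 2‖) ≤ Real.log (M / 0.355) :=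
      Real.log_le_log (by positivity) (by gcongr)
    have h3 : Real.log (M / 0.355) = 1 / 2 * (Real.log (0.671 / 0.355 ^ 2) + Real.log (√T * T)) := by
      rw [← Real.log_mul (by norm_num) (by linarith),
        show M / 0.355 = √(0.671 / 0.355 ^ 2 * (√T * T)) by
          rw [show 0.671 / 0.355 ^ 2 * (√T * T) = 0.671 * (√T * T) / 0.355 ^ 2 by ring,
            Real.sqrt_div (by positivity), Real.sqrt_sq (by norm_num)], Real.log_sqrt (by positivity)]
      ring
    have h4 : Real.log (0.671 / 0.355 ^ 2) ≤ 1.68 := by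
      rw [Real.log_le_iff_le_exp (by norm_num)]
      refine le_trans ?_ (Real.sum_le_exp_of_nonneg (by norm_num) 8)
      norm_num [Finset.sum_range_succ, Nat.factorial]
    rw [hlog] at h3
    linarith
  rw [div_le_iff₀ (by linarith)]
  have : 0 ≤ 1.5 * Real.log T + 1.6 := by linarith
  have := mul_le_mul_of_nonneg_left hl53 this
  linarith

lemma le_of_card_cos_zeros_le {θ : ℝ → ℝ} {a b n : ℝ} (hab : a ≤ b)
    (hθ : ContinuousOn θ (Icc a b)) (hb : θ b < π / 2)
    (hn : ∀ Z : Finset ℝ, (∀ x ∈ Z, x ∈ Icc a b ∧ Real.cos (θ x) = 0) → (Z.card : ℝ) ≤ n) :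
    θ a ≤ π / 2 + n * π := by
  by_contra! hlt
  have hn0 : 0 ≤ n := by simpa using hn ∅ (by simp)
  have hex : ∀ j ∈ Finset.range (⌊n⌋₊ + 1), ∃ x ∈ Icc a b, θ x = π / 2 + j * π := by
    intro j hj
    have hjn : (j : ℝ) ≤ n :=
      (Nat.cast_le.mpr (Nat.lt_succ_iff.mp (Finset.mem_range.mp hj))).trans (Nat.floor_le hn0)
    have h1 : π / 2 + j * π ≤ θ a := by
      have := mul_le_mul_of_nonneg_right hjn Real.pi_pos.le
      linarith
    have h2 : θ b ≤ π / 2 + j * π := by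
      have : 0 ≤ j * π := by positivity
      linarith
    exact intermediate_value_Icc' hab hθ ⟨h2, h1⟩
  choose! x hx hθx using hex
  have hinj : InjOn x (Finset.range (⌊n⌋₊ + 1) : Set ℕ) := by
    intro i hi j hj hij
    have := hθx i hi
    rw [hij, hθx j hj] at this
    have h := mul_right_cancel₀ Real.pi_ne_zero (add_left_cancel this)
    exact_mod_cast h.symm
  have := hn ((Finset.range (⌊n⌋₊ + 1)).image x) (by
    intro y hy
    obtain ⟨j, hj, rfl⟩ := Finset.mem_image.mp hy
    refine ⟨hx j hj, ?_⟩
    rw [hθx j hj, Real.cos_eq_zero_iff]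
    exact ⟨j, by push_cast; ring⟩)
  rw [Finset.card_image_of_injOn hinj, Finset.card_range] at this
  push_cast at this
  linarith [Nat.lt_floor_add_one n]

/-- The variation of the argument of `f` along a segment is controlled by the number of zeros of
`Re f` on it. -/
lemma abs_arg_sub_integral_le {f f' : ℝ → ℂ} {a b n : ℝ} (hab : a ≤ b)
    (hf : ∀ x ∈ Icc a b, HasDerivAt f (f' x) x) (hf' : ContinuousOn f' (Icc a b))
    (h0 : ∀ x ∈ Icc a b, f x ≠ 0) (hb : 0 < (f b).re)
    (hn : ∀ Z : Finset ℝ, (∀ x ∈ Z, x ∈ Icc a b ∧ (f x).re = 0) → (Z.card : ℝ) ≤ n) :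
    |arg (f b) - ∫ x in a..b, (f' x / f x).im| ≤ π / 2 + n * π := by
  have hfc : ContinuousOn f (Icc a b) := fun x hx ↦ (hf x hx).continuousAt.continuousWithinAt
  have hq : ContinuousOn (fun x ↦ f' x / f x) (Icc a b) := hf'.div hfc h0
  set L : ℝ → ℂ := fun x ↦ log (f b) + ∫ u in b..x, f' u / f u with hL
  have hqi : ∀ x ∈ Icc a b, IntervalIntegrable (fun x ↦ f' x / f x) volume b x := by
    intro x hx
    refine ContinuousOn.intervalIntegrable (hq.mono ?_)
    exact uIcc_subset_Icc (right_mem_Icc.mpr hab) hx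
  have hLd : ∀ x ∈ Icc a b, HasDerivWithinAt L (f' x / f x) (Icc a b) x := by
    intro x hx
    have : Fact (x ∈ Icc a b) := ⟨hx⟩
    exact (intervalIntegral.integral_hasDerivWithinAt_right (hqi x hx)
      (hq.stronglyMeasurableAtFilter_nhdsWithin measurableSet_Icc x) (hq x hx)).const_add _
  have hLc : ContinuousOn L (Icc a b) := fun x hx ↦ (hLd x hx).continuousWithinAt
  have hprod : ∀ x ∈ Icc a b, f x * exp (-L x) = f b * exp (-L b) := by
    have hd : ∀ x ∈ Icc a b, HasDerivWithinAt (fun x ↦ f x * exp (-L x)) 0 (Icc a b) x := by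
      intro x hx
      have h0x := h0 x hx
      refine (((hf x hx).hasDerivWithinAt).mul (hLd x hx).neg.cexp).congr_deriv ?_
      field_simp
      simp
    intro x hx
    have hc := (convex_Icc a b).norm_image_sub_le_of_norm_hasDerivWithin_le (C := 0) hd (by simp)
      (right_mem_Icc.mpr hab) hx
    rw [zero_mul] at hc
    exact sub_eq_zero.mp (norm_le_zero_iff.mp hc)
  have hLb : L b = log (f b) := by simp [hL]
  have hfexp : ∀ x ∈ Icc a b, f x = exp (L x) := by
    intro x hx
    have h := hprod x hx
    rw [hLb, exp_neg, exp_neg, exp_log (h0 b (right_mem_Icc.mpr hab)),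
      mul_inv_cancel₀ (h0 b (right_mem_Icc.mpr hab)), ← div_eq_mul_inv,
      div_eq_one_iff_eq (exp_ne_zero _)] at h
    exact h
  have hcos : ∀ x ∈ Icc a b, Real.cos (L x).im = 0 → (f x).re = 0 := by
    intro x hx h
    rw [hfexp x hx, exp_re, h, mul_zero]
  have hLim : ContinuousOn (fun x ↦ (L x).im) (Icc a b) := continuous_im.comp_continuousOn hLc
  have hLbim : (L b).im = arg (f b) := by rw [hLb, log_im]
  have harg := abs_lt.mp (abs_arg_lt_pi_div_two_iff.mpr (.inl hb))
  have hval : arg (f b) - ∫ x in a..b, (f' x / f x).im = (L a).im := by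
    have h := (hqi a (left_mem_Icc.mpr hab))
    have : (∫ u in b..a, f' u / f u).im = ∫ u in b..a, (f' u / f u).im :=
      (imCLM.intervalIntegral_comp_comm h).symm
    rw [hL]
    simp only [add_im, log_im, this]
    rw [intervalIntegral.integral_symm a b]
    ring
  rw [hval, abs_le]
  constructor
  · have := le_of_card_cos_zeros_le (θ := fun x ↦ -(L x).im) (n := n) hab hLim.neg
      (by simp only [hLbim]; linarith) fun Z hZ ↦ hn Z fun x hx ↦
        ⟨(hZ x hx).1, hcos x (hZ x hx).1 (by simpa using (hZ x hx).2)⟩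
    linarith
  · exact le_of_card_cos_zeros_le (θ := fun x ↦ (L x).im) (n := n) hab hLim
      (by simp only [hLbim]; linarith) fun Z hZ ↦ hn Z fun x hx ↦
        ⟨(hZ x hx).1, hcos x (hZ x hx).1 (hZ x hx).2⟩

lemma integral_im_div_eq_arg_sub_arg {f f' : ℝ → ℂ} {a b : ℝ} (hab : a ≤ b)
    (hf : ∀ x ∈ Icc a b, HasDerivAt f (f' x) x) (hf' : ContinuousOn f' (Icc a b))
    (h0 : ∀ x ∈ Icc a b, 0 < (f x).re) :
    ∫ x in a..b, (f' x / f x).im = arg (f b) - arg (f a) := by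
  have hfc : ContinuousOn f (Icc a b) := fun x hx ↦ (hf x hx).continuousAt.continuousWithinAt
  have hne : ∀ x ∈ Icc a b, f x ≠ 0 := fun x hx h ↦ by simpa [h] using h0 x hx
  have hq : ContinuousOn (fun x ↦ f' x / f x) (uIcc a b) := by
    rw [uIcc_of_le hab]; exact hf'.div hfc hne
  have h := intervalIntegral.integral_eq_sub_of_hasDerivAt (f := fun x ↦ log (f x))
    (fun x hx ↦ (hf x (by rwa [uIcc_of_le hab] at hx)).clog_real
      (.inl (h0 x (by rwa [uIcc_of_le hab] at hx)))) hq.intervalIntegrable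
  have him := imCLM.intervalIntegral_comp_comm (hq.intervalIntegrable (μ := volume))
  simp only [imCLM_apply] at him
  rw [him, h, sub_im, log_im, log_im]

/-- Derivatives of a bounded pointwise convergent sequence of holomorphic functions converge. -/
theorem tendsto_deriv_of_norm_le_sphere {f : ℕ → ℂ → ℂ} {g : ℂ → ℂ} {c : ℂ} {R C : ℝ} (hR : 0 < R)
    (hf : ∀ᶠ n in atTop, DifferentiableOn ℂ (f n) (Metric.closedBall c R))
    (hg : DifferentiableOn ℂ g (Metric.closedBall c R))
    (hC : ∀ᶠ n in atTop, ∀ z ∈ Metric.sphere c R, ‖f n z‖ ≤ C)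
    (hlim : ∀ z ∈ Metric.sphere c R, Tendsto (fun n => f n z) atTop (𝓝 (g z))) :
    Tendsto (fun n => deriv (f n) c) atTop (𝓝 (deriv g c)) := by
  have key : ∀ h : ℂ → ℂ, DifferentiableOn ℂ h (Metric.closedBall c R) →
      deriv h c = (2 * π * I)⁻¹ * ∮ z in C(c, R), (1 / (z - c) ^ 2) • h z := by
    intro h hh
    have := (DiffContOnCl.circleIntegral_one_div_sub_center_pow_smul hR 1
      (hh.diffContOnCl_ball subset_rfl))
    rw [show (1 + 1 : ℕ) = 2 from rfl] at this
    rw [this, iteratedDeriv_one]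
    have h2 : (2 * π * I : ℂ) ≠ 0 := two_pi_I_ne_zero
    simp only [Nat.factorial_one, Nat.cast_one, div_one, smul_eq_mul]
    field_simp
  rw [key g hg]
  refine Tendsto.congr' (f₁ := fun n => (2 * π * I)⁻¹ * ∮ z in C(c, R), (1 / (z - c) ^ 2) • f n z)
    ?_ ?_
  · filter_upwards [hf] with n hn using (key _ hn).symm
  refine Tendsto.const_mul _ ?_
  have hcont : ∀ h : ℂ → ℂ, DifferentiableOn ℂ h (Metric.closedBall c R) →
      Continuous fun θ : ℝ => h (circleMap c R θ) := fun h hh =>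
    hh.continuousOn.comp_continuous (continuous_circleMap c R)
      fun θ => circleMap_mem_closedBall c hR.le θ
  have hne : ∀ θ : ℝ, circleMap c R θ - c ≠ 0 := fun θ => by
    rw [sub_ne_zero]; exact circleMap_ne_center hR.ne'
  refine intervalIntegral.tendsto_integral_filter_of_dominated_convergence
    (fun _ => R * (1 / R ^ 2 * C)) ?_ ?_ intervalIntegrable_const ?_
  · filter_upwards [hf] with n hn
    refine Continuous.aestronglyMeasurable ?_
    have h1 := hcont _ hn
    have h2 : Continuous fun θ => (1 / (circleMap c R θ - c) ^ 2) :=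
      continuous_const.div (((continuous_circleMap c R).sub continuous_const).pow 2)
        fun θ => pow_ne_zero _ (hne θ)
    have h3 : Continuous fun θ => deriv (circleMap c R) θ := by
      simp only [deriv_circleMap]
      exact (continuous_circleMap 0 R).mul continuous_const
    exact h3.smul (h2.smul h1)
  · filter_upwards [hC] with n hn
    refine Eventually.of_forall fun θ _ => ?_
    have hb := hn (circleMap c R θ) (circleMap_mem_sphere c hR.le θ)
    simp only [norm_smul, deriv_circleMap, norm_mul, norm_circleMap_zero, norm_I, mul_one,
      norm_div, norm_one, norm_pow, circleMap_sub_center, abs_of_pos hR]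
    gcongr
  · refine Eventually.of_forall fun θ _ => ?_
    exact ((hlim _ (circleMap_mem_sphere c hR.le θ)).const_smul _).const_smul _

theorem norm_GammaSeq_le {s : ℂ} (hs : 0 < s.re) {n : ℕ} (hn : n ≠ 0) :
    ‖GammaSeq s n‖ ≤ Real.Gamma s.re := by
  rw [GammaSeq_eq_approx_Gamma_integral hs hn, Real.Gamma_eq_integral hs]
  have hn0 : (0 : ℝ) ≤ n := Nat.cast_nonneg n
  rw [intervalIntegral.integral_of_le hn0]
  have hint := Real.GammaIntegral_convergent hs
  calc _ ≤ ∫ x in Ioc (0 : ℝ) n, Real.exp (-x) * x ^ (s.re - 1) := by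
        refine norm_integral_le_of_norm_le (hint.mono_set Ioc_subset_Ioi_self) ?_
        refine (ae_restrict_iff' measurableSet_Ioc).2 (Eventually.of_forall fun x hx => ?_)
        have h1 : 0 ≤ 1 - x / n := by
          rw [sub_nonneg]; exact div_le_one_of_le₀ hx.2 hn0
        rw [norm_mul, norm_cpow_eq_rpow_re_of_pos hx.1, norm_real, Real.norm_eq_abs,
          abs_of_nonneg (pow_nonneg h1 n), sub_re, one_re]
        gcongr
        · exact Real.rpow_nonneg hx.1.le _
        · exact Real.one_sub_div_pow_le_exp_neg hx.2
    _ ≤ _ := setIntegral_mono_set hint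
        ((ae_restrict_iff' measurableSet_Ioi).2 (Eventually.of_forall fun x hx =>
          mul_nonneg (Real.exp_pos _).le (Real.rpow_nonneg (le_of_lt hx) _)))
        (Eventually.of_forall Ioc_subset_Ioi_self)

theorem natCast_add_ne_zero_of_re_pos {z : ℂ} (hz : 0 < z.re) (j : ℕ) : z + j ≠ 0 := fun h => by
  have h1 := congrArg re h
  simp only [add_re, natCast_re, zero_re] at h1
  have : (0 : ℝ) ≤ j := Nat.cast_nonneg j
  linarith

theorem hasDerivAt_GammaSeq {z : ℂ} (hz : 0 < z.re) {n : ℕ} (hn : n ≠ 0) :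
    HasDerivAt (fun s => GammaSeq s n)
      (GammaSeq z n * (Real.log n - ∑ j ∈ Finset.range (n + 1), 1 / (z + j))) z := by
  have hne := natCast_add_ne_zero_of_re_pos hz
  have hn0 : (n : ℂ) ≠ 0 := Nat.cast_ne_zero.2 hn
  have hp : ∏ j ∈ Finset.range (n + 1), (z + j) ≠ 0 := Finset.prod_ne_zero_iff.2 fun j _ => hne j
  have h1 : HasDerivAt (fun s : ℂ => (n : ℂ) ^ s) ((n : ℂ) ^ z * Complex.log n) z := by
    simpa using (hasDerivAt_id z).const_cpow (c := (n : ℂ)) (Or.inl hn0)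
  have h2 : HasDerivAt (fun s : ℂ => ∏ j ∈ Finset.range (n + 1), (s + j))
      ((∏ j ∈ Finset.range (n + 1), (z + j)) * ∑ j ∈ Finset.range (n + 1), 1 / (z + j)) z := by
    have := HasDerivAt.fun_finsetProd (u := Finset.range (n + 1)) (f := fun (j : ℕ) (s : ℂ) => s + j)
      (f' := fun _ => 1) (x := z) fun j _ => by simpa using (hasDerivAt_id z).add_const (j : ℂ)
    refine this.congr_deriv ?_
    rw [Finset.mul_sum]
    refine Finset.sum_congr rfl fun j hj => ?_
    rw [← Finset.mul_prod_erase _ _ hj, smul_eq_mul, mul_one]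
    field_simp [hne j]
  have h3 := (h1.mul_const (n.factorial : ℂ)).div h2 hp
  unfold GammaSeq
  refine h3.congr_deriv ?_
  rw [natCast_log]
  field_simp

theorem tendsto_digamma {z : ℂ} (hz : 0 < z.re) :
    Tendsto (fun n : ℕ => Real.log n - ∑ j ∈ Finset.range (n + 1), 1 / (z + j)) atTop
      (𝓝 (digamma z)) := by
  have hR : 0 < z.re / 2 := by linarith
  have hre : ∀ w ∈ Metric.closedBall z (z.re / 2), 0 < w.re := fun w hw => by
    have h1 := (abs_re_le_norm (w - z)).trans (mem_closedBall_iff_norm.1 hw)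
    rw [sub_re, abs_le] at h1
    linarith
  have hdG : DifferentiableOn ℂ Gamma (Metric.closedBall z (z.re / 2)) := fun w hw =>
    (differentiableAt_Gamma w fun m h => by
      have := hre w hw
      rw [h] at this
      simp only [neg_re, natCast_re, Left.neg_pos_iff] at this
      exact absurd this (not_lt.2 (Nat.cast_nonneg m))).differentiableWithinAt
  obtain ⟨C, hC⟩ : ∃ C, ∀ w ∈ Metric.closedBall z (z.re / 2), Real.Gamma w.re ≤ C := by
    have hc : ContinuousOn (fun w : ℂ => Real.Gamma w.re) (Metric.closedBall z (z.re / 2)) := by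
      refine (Real.differentiableOn_Gamma_Ioi.continuousOn).comp continuous_re.continuousOn ?_
      exact fun w hw => hre w hw
    obtain ⟨C, hC⟩ := ((isCompact_closedBall z _).bddAbove_image hc)
    exact ⟨C, fun w hw => hC ⟨w, hw, rfl⟩⟩
  have h1 : Tendsto (fun n => deriv (fun s => GammaSeq s n) z) atTop (𝓝 (deriv Gamma z)) := by
    refine tendsto_deriv_of_norm_le_sphere (C := C) hR ?_ hdG ?_ fun w _ => GammaSeq_tendsto_Gamma w
    · filter_upwards [eventually_ne_atTop 0] with n hn w hw
      exact (hasDerivAt_GammaSeq (hre w hw) hn).differentiableAt.differentiableWithinAt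
    · filter_upwards [eventually_ne_atTop 0] with n hn w hw
      have hw' := Metric.sphere_subset_closedBall hw
      exact (norm_GammaSeq_le (hre w hw') hn).trans (hC w hw')
  have h2 := h1.div (GammaSeq_tendsto_Gamma z) (Gamma_ne_zero_of_re_pos hz)
  rw [digamma_def, logDeriv_apply]
  refine h2.congr' ?_
  filter_upwards [eventually_ne_atTop 0] with n hn
  have hne : GammaSeq z n ≠ 0 := by
    unfold GammaSeq
    refine div_ne_zero (mul_ne_zero ?_ ?_) ?_
    · rw [cpow_def_of_ne_zero (Nat.cast_ne_zero.2 hn)]; exact exp_ne_zero _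
    · exact Nat.cast_ne_zero.2 n.factorial_ne_zero
    · exact Finset.prod_ne_zero_iff.2 fun j _ => natCast_add_ne_zero_of_re_pos hz j
  rw [Pi.div_apply, (hasDerivAt_GammaSeq hz hn).deriv]
  field_simp

theorem half_log_div_le {a τ : ℝ} (ha : 0 < a) (hτ : 0 < τ) :
    Real.log ((a + 1 / 2) ^ 2 + τ ^ 2) / 2 - Real.log ((a - 1 / 2) ^ 2 + τ ^ 2) / 2 ≤
      a / (a ^ 2 + τ ^ 2) +
        (1 / ((a - 1 / 2) ^ 2 + τ ^ 2) - 1 / ((a + 1 / 2) ^ 2 + τ ^ 2)) / 2 := by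
  set P := (a - 1 / 2) ^ 2 + τ ^ 2 with hP
  set Q := (a + 1 / 2) ^ 2 + τ ^ 2 with hQ
  have hP0 : 0 < P := by positivity
  have hQ0 : 0 < Q := by positivity
  have hQP : Q - P = 2 * a := by rw [hP, hQ]; ring
  have hlog : Real.log Q - Real.log P ≤ (Q / P - P / Q) / 2 := by
    have h0 : 0 ≤ Real.log (Q / P) := Real.log_nonneg (by rw [le_div_iff₀ hP0]; linarith)
    have h1 := Real.self_le_sinh_iff.2 h0
    rw [Real.sinh_eq, Real.exp_neg, Real.exp_log (by positivity), inv_div,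
      Real.log_div hQ0.ne' hP0.ne'] at h1
    exact h1
  have hm : 0 < a ^ 2 + τ ^ 2 := by positivity
  have halg : (Q / P - P / Q) / 4 ≤ a / (a ^ 2 + τ ^ 2) + (1 / P - 1 / Q) / 2 := by
    have e1 : (Q / P - P / Q) / 4 = a * (P + Q) / (2 * (P * Q)) := by
      field_simp; nlinarith
    have e2 : (1 / P - 1 / Q) / 2 = a / (P * Q) := by
      field_simp; linarith
    rw [e1, e2, div_add_div _ _ hm.ne' (by positivity), div_le_div_iff₀ (by positivity) (by positivity)]
    have e3 : P + Q = 2 * (a ^ 2 + τ ^ 2 + 1 / 4) := by rw [hP, hQ]; ring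
    have e4 : P * Q = (a ^ 2 + τ ^ 2 + 1 / 4) ^ 2 - a ^ 2 := by rw [hP, hQ]; ring
    have e5 : (a ^ 2 + τ ^ 2 - 3 / 4) * (a ^ 2 + τ ^ 2) ≤ P * Q := by
      rw [e4]; nlinarith [sq_nonneg τ]
    have hPQ : 0 < P * Q := by positivity
    rw [e3]
    have : 0 ≤ 2 * a * (P * Q) * (P * Q - (a ^ 2 + τ ^ 2 - 3 / 4) * (a ^ 2 + τ ^ 2)) := by
      apply mul_nonneg (by positivity); linarith
    nlinarith
  linarith

theorem re_digamma_quarter_le {τ : ℝ} (hτ : 0 < τ) :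
    (digamma (1 / 4 + τ * I)).re ≤
      Real.log (1 / 16 + τ ^ 2) / 2 + 1 / (1 / 16 + τ ^ 2) / 2 := by
  have hz : 0 < (1 / 4 + τ * I : ℂ).re := by simp
  have h1 := (continuous_re.tendsto _).comp (tendsto_digamma hz)
  refine le_of_tendsto h1 ?_
  filter_upwards [eventually_ne_atTop 0] with n hn
  have hterm : ∀ j : ℕ, (1 / (1 / 4 + τ * I + j : ℂ)).re = (1 / 4 + j) / ((1 / 4 + j) ^ 2 + τ ^ 2) := by
    intro j
    rw [one_div, inv_re, normSq_apply]
    have e1 : (1 / 4 + τ * I + j : ℂ).re = 1 / 4 + j := by simp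
    have e2 : (1 / 4 + τ * I + j : ℂ).im = τ := by simp
    rw [e1, e2, sq, sq]
  have hsum : ∀ m : ℕ, Real.log ((m - 1 / 4) ^ 2 + τ ^ 2) / 2 - Real.log (1 / 16 + τ ^ 2) / 2 ≤
      ∑ j ∈ Finset.range m, (1 / 4 + j) / ((1 / 4 + j) ^ 2 + τ ^ 2) +
        (1 / (1 / 16 + τ ^ 2) - 1 / ((m - 1 / 4) ^ 2 + τ ^ 2)) / 2 := by
    intro m
    induction m with
    | zero => norm_num
    | succ m ih =>
      rw [Finset.sum_range_succ]
      have h2 := half_log_div_le (a := 1 / 4 + m) (by positivity) hτ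
      have e1 : (1 / 4 + m + 1 / 2 : ℝ) = ((m + 1 : ℕ) - 1 / 4 : ℝ) := by push_cast; ring
      have e2 : (1 / 4 + m - 1 / 2 : ℝ) = (m - 1 / 4 : ℝ) := by ring
      rw [e1, e2] at h2
      linarith
  have h3 := hsum (n + 1)
  simp only [Function.comp_apply, sub_re, ofReal_re, re_sum, hterm]
  have hn1 : (1 : ℝ) ≤ n := by exact_mod_cast Nat.one_le_iff_ne_zero.2 hn
  have h4 : Real.log n ≤ Real.log (((n + 1 : ℕ) - 1 / 4 : ℝ) ^ 2 + τ ^ 2) / 2 := by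
    have h5 : Real.log ((n : ℝ) ^ 2) ≤ Real.log (((n + 1 : ℕ) - 1 / 4 : ℝ) ^ 2 + τ ^ 2) := by
      apply Real.log_le_log (by positivity)
      push_cast
      nlinarith [sq_nonneg τ]
    rw [Real.log_pow] at h5
    push_cast at h5 ⊢
    linarith
  have h6 : 0 ≤ 1 / (((n + 1 : ℕ) - 1 / 4 : ℝ) ^ 2 + τ ^ 2) := by positivity
  linarith

theorem logDeriv_Gammaℝ {s : ℂ} (hs : 0 < s.re) :
    logDeriv Gammaℝ s = -(Real.log π) / 2 + digamma (s / 2) / 2 := by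
  have hs2 : 0 < (s / 2).re := by simpa using hs
  have hπ : (π : ℂ) ≠ 0 := ofReal_ne_zero.2 Real.pi_ne_zero
  have hd : DifferentiableAt ℂ Gamma (s / 2) := differentiableAt_Gamma _ fun m h => by
      rw [h] at hs2
      simp only [neg_re, natCast_re, Left.neg_pos_iff] at hs2
      exact absurd hs2 (not_lt.2 (Nat.cast_nonneg m))
  have h1 : HasDerivAt (fun s : ℂ => (π : ℂ) ^ (-s / 2)) ((π : ℂ) ^ (-s / 2) * Complex.log π * (-1 / 2)) s :=
    ((hasDerivAt_neg s).div_const 2).const_cpow (Or.inl hπ)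
  have h2 : HasDerivAt (fun s : ℂ => Gamma (s / 2)) (deriv Gamma (s / 2) * (1 / 2)) s :=
    hd.hasDerivAt.comp s ((hasDerivAt_id s).div_const 2)
  have h3 : HasDerivAt Gammaℝ _ s := h1.mul h2
  have hG := Gamma_ne_zero_of_re_pos hs2
  have hp : (π : ℂ) ^ (-s / 2) ≠ 0 := by
    rw [cpow_def_of_ne_zero hπ]; exact exp_ne_zero _
  rw [logDeriv_apply, h3.deriv, Gammaℝ_def, digamma_def, logDeriv_apply, ofReal_log Real.pi_nonneg]
  field_simp

theorem re_logDeriv_Gammaℝ_half_le {y : ℝ} (hy : 0 < y) :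
    (logDeriv Gammaℝ (1 / 2 + y * I)).re ≤ Real.log (y / (2 * π)) / 2 + 17 / 16 / y ^ 2 := by
  rw [logDeriv_Gammaℝ (by simp)]
  have e1 : ((1 / 2 + y * I) / 2 : ℂ) = 1 / 4 + (y / 2 : ℝ) * I := by push_cast; ring
  have e2 : (-(Real.log π) / 2 + digamma (1 / 4 + (y / 2 : ℝ) * I) / 2 : ℂ).re =
      -Real.log π / 2 + (digamma (1 / 4 + (y / 2 : ℝ) * I)).re / 2 := by
    rw [add_re]
    congr 1
    · rw [← ofReal_neg]
      exact_mod_cast ofReal_re (-Real.log π / 2)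
    · exact_mod_cast div_ofReal_re _ 2
  rw [e1, e2]
  have h1 := re_digamma_quarter_le (τ := y / 2) (by positivity)
  have hy2 : 0 < (y / 2) ^ 2 := by positivity
  have h2 : Real.log (1 / 16 + (y / 2) ^ 2) ≤ 2 * Real.log (y / 2) + 1 / 16 / (y / 2) ^ 2 := by
    have h3 : 1 / 16 + (y / 2) ^ 2 = (y / 2) ^ 2 * (1 + 1 / 16 / (y / 2) ^ 2) := by
      field_simp; ring
    rw [h3, Real.log_mul hy2.ne' (by positivity), Real.log_pow]
    have := Real.log_le_sub_one_of_pos (x := 1 + 1 / 16 / (y / 2) ^ 2) (by positivity)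
    push_cast
    linarith
  have h4 : 1 / (1 / 16 + (y / 2) ^ 2) ≤ 1 / (y / 2) ^ 2 := by
    apply one_div_le_one_div_of_le hy2; linarith
  have h5 : Real.log (y / (2 * π)) = Real.log (y / 2) - Real.log π := by
    rw [← div_div, Real.log_div (by positivity) Real.pi_ne_zero]
  have h6 : 17 / 16 / y ^ 2 = (1 / 16 / (y / 2) ^ 2 + 1 / (y / 2) ^ 2 ) / 4 := by
    field_simp; ring
  rw [h5, h6]
  linarith

/-- The imaginary part of the contour integral of `f` around the rectangle `[a, b] × [c, d]`. -/
noncomputable def rectangleIntegralIm (f : ℂ → ℂ) (a b c d : ℝ) : ℝ :=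
  (∫ x in a..b, (f (x + c * I)).im) - (∫ x in a..b, (f (x + d * I)).im) +
    (∫ y in c..d, (f (b + y * I)).re) - ∫ y in c..d, (f (a + y * I)).re

/-- The boundary of the rectangle `[a, b] × [c, d]`. -/
def rectangleBoundary (a b c d : ℝ) : Set ℂ :=
  {z | z ∈ Icc a b ×ℂ Icc c d ∧ (z.re = a ∨ z.re = b ∨ z.im = c ∨ z.im = d)}

section rectangle

variable {a b c d : ℝ} {f g : ℂ → ℂ}

theorem ContinuousOn.rectangle_edges (hab : a ≤ b) (hcd : c ≤ d)
    (hf : ContinuousOn f (rectangleBoundary a b c d)) :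
    ContinuousOn (fun x : ℝ => f (x + c * I)) (uIcc a b) ∧
    ContinuousOn (fun x : ℝ => f (x + d * I)) (uIcc a b) ∧
    ContinuousOn (fun y : ℝ => f (b + y * I)) (uIcc c d) ∧
    ContinuousOn (fun y : ℝ => f (a + y * I)) (uIcc c d) := by
  rw [uIcc_of_le hab, uIcc_of_le hcd]
  refine ⟨?_, ?_, ?_, ?_⟩ <;> refine hf.comp (by fun_prop) fun x hx => ?_ <;>
    simp [rectangleBoundary, mem_reProdIm, hab, hcd, hx.1, hx.2]

theorem rectangleIntegralIm_add (hab : a ≤ b) (hcd : c ≤ d)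
    (hf : ContinuousOn f (rectangleBoundary a b c d))
    (hg : ContinuousOn g (rectangleBoundary a b c d)) :
    rectangleIntegralIm (fun z => f z + g z) a b c d =
      rectangleIntegralIm f a b c d + rectangleIntegralIm g a b c d := by
  obtain ⟨f1, f2, f3, f4⟩ := hf.rectangle_edges hab hcd
  obtain ⟨g1, g2, g3, g4⟩ := hg.rectangle_edges hab hcd
  have him : ∀ {h : ℝ → ℂ} {p q : ℝ}, ContinuousOn h (uIcc p q) →
      IntervalIntegrable (fun x => (h x).im) volume p q := fun hh =>
    (continuous_im.comp_continuousOn hh).intervalIntegrable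
  have hre : ∀ {h : ℝ → ℂ} {p q : ℝ}, ContinuousOn h (uIcc p q) →
      IntervalIntegrable (fun x => (h x).re) volume p q := fun hh =>
    (continuous_re.comp_continuousOn hh).intervalIntegrable
  simp only [rectangleIntegralIm, add_im, add_re]
  rw [intervalIntegral.integral_add (him f1) (him g1),
    intervalIntegral.integral_add (him f2) (him g2),
    intervalIntegral.integral_add (hre f3) (hre g3),
    intervalIntegral.integral_add (hre f4) (hre g4)]
  ring

theorem rectangleIntegralIm_congr (hab : a ≤ b) (hcd : c ≤ d)
    (h : EqOn f g (rectangleBoundary a b c d)) :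
    rectangleIntegralIm f a b c d = rectangleIntegralIm g a b c d := by
  unfold rectangleIntegralIm
  congr 1
  · congr 1
    · congr 1 <;> refine intervalIntegral.integral_congr fun x hx => ?_ <;>
        rw [uIcc_of_le hab] at hx <;> rw [h] <;>
        simp [rectangleBoundary, mem_reProdIm, hcd, hx.1, hx.2]
    · refine intervalIntegral.integral_congr fun x hx => ?_
      rw [uIcc_of_le hcd] at hx
      rw [h]
      simp [rectangleBoundary, mem_reProdIm, hab, hx.1, hx.2]
  · refine intervalIntegral.integral_congr fun x hx => ?_
    rw [uIcc_of_le hcd] at hx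
    rw [h]
    simp [rectangleBoundary, mem_reProdIm, hab, hx.1, hx.2]

theorem rectangleIntegralIm_eq_zero (hab : a ≤ b) (hcd : c ≤ d)
    (hf : DifferentiableOn ℂ f (Icc a b ×ℂ Icc c d)) : rectangleIntegralIm f a b c d = 0 := by
  have h := integral_boundary_rect_eq_zero_of_differentiableOn f (a + c * I) (b + d * I)
    (by simpa [uIcc_of_le hab, uIcc_of_le hcd] using hf)
  simp only [add_re, ofReal_re, mul_re, I_re, mul_zero, ofReal_im, I_im, mul_one, sub_self,
    add_zero, add_im, mul_im, zero_add] at h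
  have hsub : rectangleBoundary a b c d ⊆ Icc a b ×ℂ Icc c d := fun z hz => hz.1
  obtain ⟨f1, f2, f3, f4⟩ := (hf.continuousOn.mono hsub).rectangle_edges hab hcd
  have h' := congrArg im h
  simp only [add_im, sub_im, smul_eq_mul, mul_im, I_re, zero_mul, I_im, one_mul, zero_add,
    zero_im] at h'
  have e1 := imCLM.intervalIntegral_comp_comm (μ := volume) f1.intervalIntegrable
  have e2 := imCLM.intervalIntegral_comp_comm (μ := volume) f2.intervalIntegrable
  have e3 := reCLM.intervalIntegral_comp_comm (μ := volume) f3.intervalIntegrable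
  have e4 := reCLM.intervalIntegral_comp_comm (μ := volume) f4.intervalIntegrable
  simp only [imCLM_apply, reCLM_apply] at e1 e2 e3 e4
  rw [rectangleIntegralIm, e1, e2, e3, e4, h']

theorem integral_div_sub_sq_add_sq {k u p q : ℝ} :
    ∫ x in p..q, k / ((x - u) ^ 2 + k ^ 2) =
      Real.arctan ((q - u) / k) + Real.arctan ((u - p) / k) := by
  have h := intervalIntegral.integral_comp_sub_right (a := p) (b := q)
    (fun x : ℝ => k / (k ^ 2 + x ^ 2)) u
  rw [integral_div_sq_add_sq, ← neg_sub u p, neg_div, Real.arctan_neg, sub_neg_eq_add] at h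
  simpa only [add_comm (k ^ 2)] using h

theorem rectangleIntegralIm_inv_sub {ρ : ℂ} (ha : a < ρ.re) (hb : ρ.re < b) (hc : c < ρ.im)
    (hd : ρ.im < d) : rectangleIntegralIm (fun z => (z - ρ)⁻¹) a b c d = 2 * π := by
  have e1 : ∀ x : ℝ, ((x + c * I - ρ)⁻¹ : ℂ).im = (ρ.im - c) / ((x - ρ.re) ^ 2 + (ρ.im - c) ^ 2) := by
    intro x; rw [inv_im, normSq_apply]; simp; congr 1; ring
  have e2 : ∀ x : ℝ, ((x + d * I - ρ)⁻¹ : ℂ).im = -((d - ρ.im) / ((x - ρ.re) ^ 2 + (d - ρ.im) ^ 2)) := by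
    intro x; rw [inv_im, normSq_apply, ← neg_div]; simp; congr 1; ring
  have e3 : ∀ y : ℝ, ((b + y * I - ρ)⁻¹ : ℂ).re = (b - ρ.re) / ((y - ρ.im) ^ 2 + (b - ρ.re) ^ 2) := by
    intro x; rw [inv_re, normSq_apply]; simp; congr 1; ring
  have e4 : ∀ y : ℝ, ((a + y * I - ρ)⁻¹ : ℂ).re = -((ρ.re - a) / ((y - ρ.im) ^ 2 + (ρ.re - a) ^ 2)) := by
    intro x; rw [inv_re, normSq_apply, ← neg_div]; simp; congr 1; ring
  have hi : ∀ p q : ℝ, 0 < p → 0 < q → Real.arctan (p / q) + Real.arctan (q / p) = π / 2 := by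
    intro p q hp hq
    rw [← inv_div, Real.arctan_inv_of_pos (by positivity)]; ring
  simp only [rectangleIntegralIm, e1, e2, e3, e4, intervalIntegral.integral_neg]
  rw [integral_div_sub_sq_add_sq, integral_div_sub_sq_add_sq, integral_div_sub_sq_add_sq,
    integral_div_sub_sq_add_sq]
  have h1 := hi (b - ρ.re) (ρ.im - c) (by linarith) (by linarith)
  have h2 := hi (ρ.re - a) (ρ.im - c) (by linarith) (by linarith)
  have h3 := hi (b - ρ.re) (d - ρ.im) (by linarith) (by linarith)
  have h4 := hi (ρ.re - a) (d - ρ.im) (by linarith) (by linarith)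
  linarith

theorem rectangleIntegralIm_const_mul {k : ℝ} :
    rectangleIntegralIm (fun z => k * f z) a b c d = k * rectangleIntegralIm f a b c d := by
  simp only [rectangleIntegralIm, re_ofReal_mul, im_ofReal_mul,
    intervalIntegral.integral_const_mul]
  ring

/-- The number of distinct zeros in a rectangle is at most the change of argument along
the boundary. -/
theorem card_zeros_le_rectangleIntegralIm (hab : a < b) (hcd : c < d) (Z : Finset ℂ) {F : ℂ → ℂ}
    (hF : AnalyticOnNhd ℂ F (Icc a b ×ℂ Icc c d))
    (hZ : ∀ z ∈ Icc a b ×ℂ Icc c d, F z = 0 ↔ z ∈ Z)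
    (hint : ∀ z ∈ Z, z ∈ Ioo a b ×ℂ Ioo c d) :
    2 * π * Z.card ≤ rectangleIntegralIm (logDeriv F) a b c d := by
  have hbd : ∀ z ∈ rectangleBoundary a b c d, z ∉ Ioo a b ×ℂ Ioo c d := by
    rintro z ⟨-, h⟩ hz
    rw [mem_reProdIm] at hz
    rcases h with h | h | h | h
    · exact hz.1.1.ne' h
    · exact hz.1.2.ne h
    · exact hz.2.1.ne' h
    · exact hz.2.2.ne h
  have hsub : rectangleBoundary a b c d ⊆ Icc a b ×ℂ Icc c d := fun z hz => hz.1
  have hIoo : Ioo a b ×ℂ Ioo c d ⊆ Icc a b ×ℂ Icc c d := fun z hz =>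
    ⟨Ioo_subset_Icc_self hz.1, Ioo_subset_Icc_self hz.2⟩
  induction Z using Finset.induction_on generalizing F with
  | empty =>
    rw [rectangleIntegralIm_eq_zero hab.le hcd.le]
    · simp
    · intro z hz
      have h0 : F z ≠ 0 := fun h => by simpa using (hZ z hz).1 h
      exact ((hF z hz).deriv.differentiableAt.div (hF z hz).differentiableAt h0).differentiableWithinAt
  | insert ρ Z hρ ih =>
    have hρi := hint ρ (Finset.mem_insert_self _ _)
    have hρK := hIoo hρi
    have hρ0 : F ρ = 0 := (hZ ρ hρK).2 (Finset.mem_insert_self _ _)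
    have hopen : Ioo a b ×ℂ Ioo c d ∈ 𝓝 ρ := (isOpen_Ioo.reProdIm isOpen_Ioo).mem_nhds hρi
    have htop : analyticOrderAt F ρ ≠ ⊤ := by
      rw [Ne, analyticOrderAt_eq_top]
      intro h
      have h1 : ∀ᶠ z in 𝓝 ρ, z ∈ (insert ρ Z : Finset ℂ) := by
        filter_upwards [h, hopen] with z hz hz' using (hZ z (hIoo hz')).1 hz
      exact (infinite_of_mem_nhds ρ h1) (Finset.finite_toSet _)
    obtain ⟨h, hh, hh0, hFh⟩ := (hF ρ hρK).analyticOrderAt_ne_top.1 htop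
    set m := analyticOrderNatAt F ρ with hm
    have hm1 : 1 ≤ m := by
      rw [Nat.one_le_iff_ne_zero]
      intro h0
      have h1 : F ρ = (ρ - ρ) ^ m • h ρ := hFh.self_of_nhds
      rw [h0, pow_zero, one_smul, hρ0] at h1
      exact hh0 h1.symm
    set F1 : ℂ → ℂ := Function.update (fun z => F z / (z - ρ) ^ m) ρ (h ρ) with hF1
    have hF1ρ : F1 =ᶠ[𝓝 ρ] h := by
      filter_upwards [hFh] with z hz
      rcases eq_or_ne z ρ with rfl | hne
      · simp [hF1]
      · rw [hF1, Function.update_of_ne hne, hz, smul_eq_mul]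
        have : (z - ρ) ^ m ≠ 0 := pow_ne_zero _ (sub_ne_zero.2 hne)
        field_simp
    have hF1z : ∀ z, z ≠ ρ → F1 =ᶠ[𝓝 z] fun z => F z / (z - ρ) ^ m := fun z hz => by
      filter_upwards [isOpen_ne.mem_nhds hz] with w hw
      rw [hF1, Function.update_of_ne hw]
    have hF1an : AnalyticOnNhd ℂ F1 (Icc a b ×ℂ Icc c d) := fun z hz => by
      rcases eq_or_ne z ρ with rfl | hne
      · exact hh.congr hF1ρ.symm
      · refine AnalyticAt.congr ?_ (hF1z z hne).symm
        exact (hF z hz).div ((analyticAt_id.sub analyticAt_const).pow m)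
          (pow_ne_zero _ (sub_ne_zero.2 hne))
    have hzero : ∀ z ∈ Icc a b ×ℂ Icc c d, F1 z = 0 ↔ z ∈ Z := fun z hz => by
      rcases eq_or_ne z ρ with rfl | hne
      · rw [hF1ρ.self_of_nhds]
        exact ⟨fun h => absurd h hh0, fun h => absurd h hρ⟩
      · have hp : (z - ρ) ^ m ≠ 0 := pow_ne_zero _ (sub_ne_zero.2 hne)
        rw [(hF1z z hne).self_of_nhds, div_eq_zero_iff, or_iff_left hp, hZ z hz,
          Finset.mem_insert, or_iff_right hne]
    have hI := ih hF1an hzero fun z hz => hint z (Finset.mem_insert_of_mem hz)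
    have hneρ : ∀ z ∈ rectangleBoundary a b c d, z ≠ ρ := fun z hz h => hbd z hz (h ▸ hρi)
    have hF1ne : ∀ z ∈ rectangleBoundary a b c d, F1 z ≠ 0 := fun z hz h0 =>
      hbd z hz (hint z (Finset.mem_insert_of_mem ((hzero z (hsub hz)).1 h0)))
    have hcongr : EqOn (logDeriv F) (fun z => logDeriv F1 z + (m : ℝ) * (z - ρ)⁻¹)
        (rectangleBoundary a b c d) := fun z hz => by
      have hne := hneρ z hz
      have h1 : F =ᶠ[𝓝 z] fun z => F1 z * (z - ρ) ^ m := by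
        filter_upwards [hF1z z hne, isOpen_ne.mem_nhds hne] with w hw hw'
        have : (w - ρ) ^ m ≠ 0 := pow_ne_zero _ (sub_ne_zero.2 hw')
        rw [hw]; field_simp
      have hd1 := (hF1an z (hsub hz)).differentiableAt
      have hs : DifferentiableAt ℂ (fun z : ℂ => z - ρ) z := by fun_prop
      have hp : (z - ρ) ^ m ≠ 0 := pow_ne_zero _ (sub_ne_zero.2 hne)
      have h2 : logDeriv (fun z => F1 z * (z - ρ) ^ m) z = _ :=
        logDeriv_mul (f := F1) (g := fun z => (z - ρ) ^ m) z (hF1ne z hz) hp hd1 (hs.pow m)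
      rw [(logDeriv_congr_nhds h1).self_of_nhds, h2, logDeriv_fun_pow hs m,
        logDeriv_apply (fun z : ℂ => z - ρ)]
      simp
    rw [rectangleIntegralIm_congr hab.le hcd.le hcongr, rectangleIntegralIm_add hab.le hcd.le,
      rectangleIntegralIm_const_mul, rectangleIntegralIm_inv_sub hρi.1.1 hρi.1.2 hρi.2.1 hρi.2.2,
      Finset.card_insert_of_notMem hρ]
    · have : (1 : ℝ) ≤ m := by exact_mod_cast hm1
      push_cast
      nlinarith [Real.pi_pos]
    · intro z hz
      have han := hF1an z (hsub hz)
      exact (han.deriv.continuousAt.div han.continuousAt (hF1ne z hz)).continuousWithinAt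
    · refine continuousOn_const.mul (ContinuousOn.inv₀ (by fun_prop) fun z hz => ?_)
      exact sub_ne_zero.2 (hneρ z hz)

end rectangle

theorem completedRiemannZeta_eq_Gammaℝ_mul {s : ℂ} (hs : 0 < s.re) :
    completedRiemannZeta s = Gammaℝ s * riemannZeta s := by
  have h0 : s ≠ 0 := fun h => by simp [h] at hs
  rw [riemannZeta_def_of_ne_zero h0, mul_div_cancel₀ _ (Gammaℝ_ne_zero_of_re_pos hs)]

theorem completedRiemannZeta_eq_zero_iff {s : ℂ} :
    completedRiemannZeta s = 0 ↔ riemannZeta s = 0 ∧ 0 < s.re ∧ s.re < 1 := by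
  rcases lt_or_ge 0 s.re with h | h
  · rw [completedRiemannZeta_eq_Gammaℝ_mul h, mul_eq_zero,
      or_iff_right (Gammaℝ_ne_zero_of_re_pos h)]
    refine ⟨fun h0 => ⟨h0, h, ?_⟩, fun h0 => h0.1⟩
    by_contra! h1
    exact riemannZeta_ne_zero_of_one_le_re h1 h0
  · have h1 : 1 ≤ (1 - s).re := by rw [sub_re, one_re]; linarith
    rw [← completedRiemannZeta_one_sub, completedRiemannZeta_eq_Gammaℝ_mul (by linarith)]
    refine iff_of_false (mul_ne_zero (Gammaℝ_ne_zero_of_re_pos (by linarith))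
      (riemannZeta_ne_zero_of_one_le_re h1)) fun h2 => absurd h2.2.1 (not_lt.2 h)

theorem Gammaℝ_conj (s : ℂ) : Gammaℝ (conj s) = conj (Gammaℝ s) := by
  rw [Gammaℝ_def, Gammaℝ_def, map_mul, ← Gamma_conj, map_div₀, show conj (2 : ℂ) = 2 from conj_ofNat 2]
  congr 1
  have h := cpow_conj π (-s / 2) (by rw [arg_ofReal_of_nonneg Real.pi_nonneg]; exact Real.pi_ne_zero.symm)
  rw [conj_ofReal] at h
  rw [← h, map_div₀, map_neg, show conj (2 : ℂ) = 2 from conj_ofNat 2]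

theorem completedRiemannZeta_conj (s : ℂ) :
    completedRiemannZeta (conj s) = conj (completedRiemannZeta s) := by
  have key : ∀ w : ℂ, 0 < w.re →
      completedRiemannZeta (conj w) = conj (completedRiemannZeta w) := fun w hw => by
    rw [completedRiemannZeta_eq_Gammaℝ_mul hw, completedRiemannZeta_eq_Gammaℝ_mul (by rwa [conj_re]),
      Gammaℝ_conj, riemannZeta_conj, map_mul]
  rcases lt_or_ge 0 s.re with h | h
  · exact key s h
  · rw [← completedRiemannZeta_one_sub s, ← key _ (by rw [sub_re, one_re]; linarith), map_sub, map_one,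
      completedRiemannZeta_one_sub]

theorem logDeriv_completedRiemannZeta_one_sub_conj (s : ℂ) :
    logDeriv completedRiemannZeta (1 - conj s) = -conj (logDeriv completedRiemannZeta s) := by
  have h1 : deriv completedRiemannZeta (1 - conj s) = -deriv completedRiemannZeta (conj s) := by
    have := deriv_comp_const_sub completedRiemannZeta 1 (conj s)
    simp only [completedRiemannZeta_one_sub] at this
    rw [this, neg_neg]
  have h2 : deriv completedRiemannZeta (conj s) = conj (deriv completedRiemannZeta s) := by
    have h := deriv_conj_conj (𝕜 := ℂ) (f := completedRiemannZeta)
    have h3 : ⇑(conj) ∘ completedRiemannZeta ∘ ⇑(conj) = completedRiemannZeta := by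
      funext w
      simp [completedRiemannZeta_conj]
    rw [h3] at h
    simpa using congrFun h (conj s)
  rw [logDeriv_apply, logDeriv_apply, h1, h2, completedRiemannZeta_one_sub,
    completedRiemannZeta_conj, map_div₀, neg_div]

theorem analyticAt_Gammaℝ {s : ℂ} (hs : 0 < s.re) : AnalyticAt ℂ Gammaℝ s := by
  have h := (differentiable_Gammaℝ_inv.analyticAt s).inv (inv_ne_zero (Gammaℝ_ne_zero_of_re_pos hs))
  refine h.congr (Eventually.of_forall fun z => ?_)
  simp

theorem analyticAt_completedRiemannZeta {s : ℂ} (h0 : s ≠ 0) (h1 : s ≠ 1) :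
    AnalyticAt ℂ completedRiemannZeta s := by
  have hopen : IsOpen {z : ℂ | z ≠ 0 ∧ z ≠ 1} := isOpen_ne.inter isOpen_ne
  exact DifferentiableOn.analyticAt (s := {z : ℂ | z ≠ 0 ∧ z ≠ 1})
    (fun z hz => (differentiableAt_completedZeta hz.1 hz.2).differentiableWithinAt)
    (hopen.mem_nhds ⟨h0, h1⟩)

theorem logDeriv_completedRiemannZeta_eq_add {s : ℂ} (hs : 0 < s.re) (h1 : s ≠ 1)
    (hz : riemannZeta s ≠ 0) :
    logDeriv completedRiemannZeta s = logDeriv Gammaℝ s + logDeriv riemannZeta s := by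
  have h : completedRiemannZeta =ᶠ[𝓝 s] fun z => Gammaℝ z * riemannZeta z := by
    filter_upwards [(isOpen_lt continuous_const continuous_re).mem_nhds hs] with z hz using
      completedRiemannZeta_eq_Gammaℝ_mul hz
  rw [(logDeriv_congr_nhds h).self_of_nhds]
  exact logDeriv_mul s (Gammaℝ_ne_zero_of_re_pos hs) hz (analyticAt_Gammaℝ hs).differentiableAt
    (differentiableAt_riemannZeta h1)

theorem ne_zero_and_ne_one_of_im_pos {s : ℂ} (hs : 0 < s.im) : s ≠ 0 ∧ s ≠ 1 :=
  ⟨fun h => by simp [h] at hs, fun h => by simp [h] at hs⟩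

theorem continuousAt_logDeriv_of_analyticAt {f : ℂ → ℂ} {s : ℂ} (hf : AnalyticAt ℂ f s)
    (h0 : f s ≠ 0) : ContinuousAt (logDeriv f) s :=
  hf.deriv.continuousAt.div hf.continuousAt h0

theorem integral_im_logDeriv_completedRiemannZeta {T : ℝ} (hT : 0 < T)
    (h0 : ∀ x : ℝ, riemannZeta (x + T * I) ≠ 0) :
    ∫ x in (-1 : ℝ)..2, (logDeriv completedRiemannZeta (x + T * I)).im =
      2 * ((∫ x in (1 / 2 : ℝ)..2, (logDeriv Gammaℝ (x + T * I)).im) +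
        ∫ x in (1 / 2 : ℝ)..2, (logDeriv riemannZeta (x + T * I)).im) := by
  set f : ℝ → ℝ := fun x => (logDeriv completedRiemannZeta (x + T * I)).im with hf
  have him : ∀ x : ℝ, 0 < (x + T * I : ℂ).im := fun x => by simpa using hT
  have hcont : Continuous f := by
    refine continuous_im.comp (continuous_iff_continuousAt.2 fun x => ?_)
    have hx := ne_zero_and_ne_one_of_im_pos (him x)
    refine ContinuousAt.comp' (continuousAt_logDeriv_of_analyticAt
      (analyticAt_completedRiemannZeta hx.1 hx.2) fun h => ?_) (by fun_prop)
    exact h0 x (completedRiemannZeta_eq_zero_iff.1 h).1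
  have hsym : ∀ x : ℝ, f (1 - x) = f x := fun x => by
    have h := logDeriv_completedRiemannZeta_one_sub_conj (x + T * I)
    have e : (1 - conj (x + T * I : ℂ)) = ((1 - x : ℝ) : ℂ) + T * I := by
      simp only [map_add, map_mul, conj_ofReal, conj_I]
      push_cast
      ring
    rw [e] at h
    simp only [hf]
    rw [h, neg_im, conj_im, neg_neg]
  have h1 : ∫ x in (-1 : ℝ)..(1 / 2), f x = ∫ x in (1 / 2 : ℝ)..2, f x := by
    have h := intervalIntegral.integral_comp_sub_left (a := 1 / 2) (b := 2) f 1
    simp only [hsym] at h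
    rw [h]
    norm_num
  rw [← intervalIntegral.integral_add_adjacent_intervals (hcont.intervalIntegrable (-1) (1 / 2))
    (hcont.intervalIntegrable _ _), h1, ← two_mul]
  congr 1
  have hG : ContinuousOn (fun x : ℝ => (logDeriv Gammaℝ (x + T * I)).im) (uIcc (1 / 2) 2) := by
    refine continuous_im.comp_continuousOn fun x hx => ?_
    rw [uIcc_of_le (by norm_num)] at hx
    have hx0 : 0 < (x + T * I : ℂ).re := by simpa using lt_of_lt_of_le (by norm_num) hx.1
    exact ((continuousAt_logDeriv_of_analyticAt (analyticAt_Gammaℝ hx0)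
      (Gammaℝ_ne_zero_of_re_pos hx0)).comp' (f := fun x : ℝ => (x + T * I : ℂ))
        (by fun_prop)).continuousWithinAt
  have hZ : Continuous (fun x : ℝ => (logDeriv riemannZeta (x + T * I)).im) := by
    refine continuous_im.comp (continuous_iff_continuousAt.2 fun x => ?_)
    have hx := ne_zero_and_ne_one_of_im_pos (him x)
    exact ContinuousAt.comp' (continuousAt_logDeriv_of_analyticAt
      (analyticOn_riemannZeta _ hx.2) (h0 x)) (by fun_prop)
  rw [← intervalIntegral.integral_add hG.intervalIntegrable (hZ.intervalIntegrable _ _)]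
  refine intervalIntegral.integral_congr fun x hx => ?_
  rw [uIcc_of_le (by norm_num)] at hx
  have hx0 : 0 < (x + T * I : ℂ).re := by simpa using lt_of_lt_of_le (by norm_num) hx.1
  simp only [hf]
  rw [logDeriv_completedRiemannZeta_eq_add hx0 (ne_zero_and_ne_one_of_im_pos (him x)).2 (h0 x), add_im]

theorem abs_arg_riemannZeta_sub_integral_le {T : ℝ} (hT : 17 ≤ T)
    (h0 : ∀ x : ℝ, riemannZeta (x + T * I) ≠ 0) :
    |arg (riemannZeta (2 + T * I)) -
      ∫ x in (1 / 2 : ℝ)..2, (logDeriv riemannZeta (x + T * I)).im| ≤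
      π / 2 + (1.5 * Real.log T + 1.6) * π := by
  have him : ∀ x : ℝ, 0 < (x + T * I : ℂ).im := fun x => by simp; linarith
  have h1 : ∀ x : ℝ, (x + T * I : ℂ) ≠ 1 := fun x => (ne_zero_and_ne_one_of_im_pos (him x)).2
  have h := abs_arg_sub_integral_le (f := fun x : ℝ => riemannZeta (x + T * I))
    (f' := fun x : ℝ => deriv riemannZeta (x + T * I)) (a := 1 / 2) (b := 2)
    (n := 1.5 * Real.log T + 1.6) (by norm_num) ?_ ?_ (fun x _ => h0 x) ?_ ?_
  · simpa [logDeriv_apply] using h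
  · intro x _
    have h2 := (differentiableAt_riemannZeta (h1 x)).hasDerivAt
    have h3 : HasDerivAt (fun z : ℂ => z + T * I) 1 (x : ℂ) := (hasDerivAt_id _).add_const _
    simpa using (HasDerivAt.comp (x : ℂ) h2 h3).comp_ofReal
  · refine (continuous_iff_continuousAt.2 fun x => ?_).continuousOn
    exact ContinuousAt.comp' ((analyticOn_riemannZeta _ (h1 x)).deriv.continuousAt) (by fun_prop)
  · have := re_riemannZeta_two_add_ge (y := T)
    push_cast
    linarith
  · intro Z hZ
    exact card_re_riemannZeta_zeros_le hT fun x hx => ⟨(hZ x hx).1.1, (hZ x hx).1.2, (hZ x hx).2⟩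

theorem integral_re_logDeriv_riemannZeta_two {T₁ T₂ : ℝ} (h : T₁ ≤ T₂) :
    ∫ y in T₁..T₂, (logDeriv riemannZeta (2 + y * I)).re =
      arg (riemannZeta (2 + T₂ * I)) - arg (riemannZeta (2 + T₁ * I)) := by
  have h1 : ∀ y : ℝ, (2 + y * I : ℂ) ≠ 1 := fun y h => by simpa using congrArg re h
  rw [← integral_im_div_eq_arg_sub_arg (f := fun y : ℝ => riemannZeta (2 + y * I))
    (f' := fun y : ℝ => deriv riemannZeta (2 + y * I) * I) h]
  · refine intervalIntegral.integral_congr fun y _ => ?_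
    simp only [logDeriv_apply]
    rw [mul_div_right_comm]
    simp
  · intro y _
    have h2 := (differentiableAt_riemannZeta (h1 y)).hasDerivAt
    have h3 : HasDerivAt (fun z : ℂ => 2 + z * I) I (y : ℂ) := by
      simpa using ((hasDerivAt_id (y : ℂ)).mul_const I).const_add 2
    exact (HasDerivAt.comp (y : ℂ) h2 h3).comp_ofReal
  · refine (continuous_iff_continuousAt.2 fun x => ?_).continuousOn
    refine ContinuousAt.mul (f := fun y : ℝ => deriv riemannZeta (2 + y * I)) ?_ continuousAt_const
    exact ContinuousAt.comp' (f := fun y : ℝ => (2 + y * I : ℂ))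
      ((analyticOn_riemannZeta _ (h1 x)).deriv.continuousAt) (by fun_prop)
  · intro y _
    have := re_riemannZeta_two_add_ge (y := y)
    linarith

theorem card_riemannZeta_zeros_le {T₁ T₂ : ℝ} (hT₁ : 17 ≤ T₁) (h12 : T₁ < T₂)
    (h1 : ∀ x : ℝ, riemannZeta (x + T₁ * I) ≠ 0) (h2 : ∀ x : ℝ, riemannZeta (x + T₂ * I) ≠ 0)
    {Z : Finset ℂ} (hZ : ∀ ρ ∈ Z, riemannZeta ρ = 0 ∧ 0 < ρ.re ∧ ρ.re < 1 ∧ T₁ < ρ.im ∧ ρ.im < T₂) :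
    (Z.card : ℝ) ≤ 1 / π * (∫ y in T₁..T₂, (logDeriv Gammaℝ (1 / 2 + y * I)).re) +
      1.5 * Real.log T₁ + 1.5 * Real.log T₂ + 4.2 := by
  have hT0 : 0 < T₁ := by linarith
  set K : Set ℂ := Icc (-1 : ℝ) 2 ×ℂ Icc T₁ T₂ with hK
  have hKim : ∀ z ∈ K, 0 < z.im := fun z hz => hT0.trans_le hz.2.1
  have hKan : AnalyticOnNhd ℂ completedRiemannZeta K := fun z hz =>
    analyticAt_completedRiemannZeta (ne_zero_and_ne_one_of_im_pos (hKim z hz)).1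
      (ne_zero_and_ne_one_of_im_pos (hKim z hz)).2
  have hfin : (K ∩ {z | completedRiemannZeta z = 0}).Finite := by
    have hc : IsCompact K := isCompact_Icc.reProdIm isCompact_Icc
    refine hc.inter_riemannZetaZeros_finite.subset fun z hz => ⟨hz.1, ?_⟩
    exact (completedRiemannZeta_eq_zero_iff.1 hz.2).1
  have hline : ∀ {T : ℝ} (z : ℂ), z.im = T → (z.re + T * I : ℂ) = z := fun {T} z hz => by
    rw [← hz, re_add_im]
  have hcard : Z.card ≤ hfin.toFinset.card := by
    refine Finset.card_le_card fun ρ hρ => ?_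
    obtain ⟨h, h3, h4, h5, h6⟩ := hZ ρ hρ
    rw [Set.Finite.mem_toFinset]
    exact ⟨⟨⟨by linarith, by linarith⟩, h5.le, h6.le⟩,
      completedRiemannZeta_eq_zero_iff.2 ⟨h, h3, h4⟩⟩
  have hmain := card_zeros_le_rectangleIntegralIm (a := -1) (b := 2) (c := T₁) (d := T₂) (by norm_num)
    h12 hfin.toFinset hKan (fun z hz => by
      rw [Set.Finite.mem_toFinset]; exact ⟨fun h => ⟨hz, h⟩, fun h => h.2⟩) (fun z hz => by
      rw [Set.Finite.mem_toFinset] at hz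
      obtain ⟨h, h3, h4⟩ := completedRiemannZeta_eq_zero_iff.1 hz.2
      refine ⟨⟨by linarith, by linarith⟩, lt_of_le_of_ne hz.1.2.1 fun he => ?_,
        lt_of_le_of_ne hz.1.2.2 fun he => ?_⟩
      · exact h1 z.re (by rwa [hline z he.symm])
      · exact h2 z.re (by rwa [hline z he]))
  have hG := rectangleIntegralIm_eq_zero (a := 1 / 2) (b := 2) (f := logDeriv Gammaℝ) (by norm_num) h12.le
    (fun z hz => by
      have hz0 : 0 < z.re := lt_of_lt_of_le (by norm_num) hz.1.1
      exact ((analyticAt_Gammaℝ hz0).deriv.div (analyticAt_Gammaℝ hz0)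
        (Gammaℝ_ne_zero_of_re_pos hz0)).differentiableAt.differentiableWithinAt)
  have hleft : ∫ y in T₁..T₂, (logDeriv completedRiemannZeta ((-1 : ℝ) + y * I)).re =
      -∫ y in T₁..T₂, (logDeriv completedRiemannZeta ((2 : ℝ) + y * I)).re := by
    rw [← intervalIntegral.integral_neg]
    refine intervalIntegral.integral_congr fun y _ => ?_
    have h := logDeriv_completedRiemannZeta_one_sub_conj ((2 : ℝ) + y * I)
    have e : (1 - conj ((2 : ℝ) + y * I : ℂ)) = ((-1 : ℝ) : ℂ) + y * I := by
      simp only [map_add, map_mul, conj_ofReal, conj_I]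
      push_cast
      ring
    rw [e] at h
    simp only [h, neg_re, conj_re]
  have hright : ∫ y in T₁..T₂, (logDeriv completedRiemannZeta ((2 : ℝ) + y * I)).re =
      (∫ y in T₁..T₂, (logDeriv Gammaℝ ((2 : ℝ) + y * I)).re) +
        (arg (riemannZeta (2 + T₂ * I)) - arg (riemannZeta (2 + T₁ * I))) := by
    rw [← integral_re_logDeriv_riemannZeta_two h12.le]
    have hre : ∀ y : ℝ, ((2 : ℝ) + y * I : ℂ).re = 2 := fun y => by simp
    have hre0 : ∀ y : ℝ, 0 < ((2 : ℝ) + y * I : ℂ).re := fun y => by rw [hre]; norm_num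
    have hne : ∀ y : ℝ, ((2 : ℝ) + y * I : ℂ) ≠ 1 := fun y h => by
      have := congrArg re h
      rw [hre] at this
      norm_num at this
    have hz0 : ∀ y : ℝ, riemannZeta ((2 : ℝ) + y * I) ≠ 0 := fun y =>
      riemannZeta_ne_zero_of_one_le_re (by rw [hre]; norm_num)
    rw [← intervalIntegral.integral_add]
    · refine intervalIntegral.integral_congr fun y _ => ?_
      simp only [logDeriv_completedRiemannZeta_eq_add (hre0 y) (hne y) (hz0 y), add_re]
      norm_num
    · refine (continuous_re.comp (continuous_iff_continuousAt.2 fun y => ?_)).intervalIntegrable _ _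
      exact ContinuousAt.comp' (continuousAt_logDeriv_of_analyticAt (analyticAt_Gammaℝ (hre0 y))
        (Gammaℝ_ne_zero_of_re_pos (hre0 y))) (by fun_prop)
    · refine (continuous_re.comp (continuous_iff_continuousAt.2 fun y => ?_)).intervalIntegrable _ _
      have := continuousAt_logDeriv_of_analyticAt (analyticOn_riemannZeta _ (hne y)) (hz0 y)
      rw [ofReal_ofNat] at this
      exact ContinuousAt.comp' this (by fun_prop)
  have hb1 := (abs_le.1 (abs_arg_riemannZeta_sub_integral_le hT₁ h1)).1
  have hb2 := (abs_le.1 (abs_arg_riemannZeta_sub_integral_le (hT₁.trans h12.le) h2)).2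
  have hhalf : ∫ y in T₁..T₂, (logDeriv Gammaℝ ((1 / 2 : ℝ) + y * I)).re =
      ∫ y in T₁..T₂, (logDeriv Gammaℝ (1 / 2 + y * I)).re := by
    push_cast; rfl
  rw [rectangleIntegralIm, integral_im_logDeriv_completedRiemannZeta hT0 h1,
    integral_im_logDeriv_completedRiemannZeta (hT0.trans h12) h2, hleft, hright] at hmain
  rw [rectangleIntegralIm, hhalf] at hG
  have hcard' : (Z.card : ℝ) ≤ hfin.toFinset.card := by exact_mod_cast hcard
  have hπ := Real.pi_pos
  have hfinal : π * Z.card ≤ (∫ y in T₁..T₂, (logDeriv Gammaℝ (1 / 2 + y * I)).re) +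
      π * (1.5 * Real.log T₁ + 1.5 * Real.log T₂ + 4.2) := by
    have := mul_le_mul_of_nonneg_left hcard' hπ.le
    linarith
  rw [← le_div_iff₀' hπ, add_div, mul_div_cancel_left₀ _ hπ.ne'] at hfinal
  rw [one_div_mul_eq_div]
  linarith

theorem countable_riemannZetaZeros : riemannZetaZeros.Countable := by
  have h : riemannZetaZeros = ⋃ n : ℕ, Metric.closedBall (0 : ℂ) n ∩ riemannZetaZeros := by
    rw [← iUnion_inter, Metric.iUnion_closedBall_nat, univ_inter]
  rw [h]
  exact countable_iUnion fun n =>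
    ((isCompact_closedBall (0 : ℂ) n).inter_riemannZetaZeros_finite).countable

theorem countable_im_riemannZetaZeros : (Complex.im '' riemannZetaZeros).Countable :=
  countable_riemannZetaZeros.image _

theorem riemannZeta_ne_zero_of_im_notMem {y : ℝ} (hy : y ∉ Complex.im '' riemannZetaZeros) (x : ℝ) :
    riemannZeta (x + y * I) ≠ 0 := fun h => hy ⟨x + y * I, h, by simp⟩

/-- The main term `(u log (u / 2π) - u) / 2π` of the Riemann–von Mangoldt formula. -/
noncomputable def riemannVonMangoldtMain (u : ℝ) : ℝ :=
  (u * Real.log (u / (2 * π)) - u) / (2 * π)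

theorem hasDerivAt_riemannVonMangoldtMain {u : ℝ} (hu : 0 < u) :
    HasDerivAt riemannVonMangoldtMain (Real.log (u / (2 * π)) / (2 * π)) u := by
  have hpi := Real.pi_pos
  have h1 : HasDerivAt (fun u : ℝ => u / (2 * π)) (1 / (2 * π)) u :=
    (hasDerivAt_id u).div_const _
  have h2 := (((hasDerivAt_id u).mul (h1.log (by positivity))).sub (hasDerivAt_id u)).div_const
    (2 * π)
  refine h2.congr_deriv ?_
  simp only [id]
  field_simp
  ring

theorem integral_re_logDeriv_Gammaℝ_half_le {a b : ℝ} (ha : 17 ≤ a) (hab : a ≤ b) :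
    1 / π * (∫ y in a..b, (logDeriv Gammaℝ (1 / 2 + y * I)).re) ≤
      riemannVonMangoldtMain b - riemannVonMangoldtMain a + 0.02 := by
  have hpi := Real.pi_pos
  have hpos : ∀ y ∈ uIcc a b, 0 < y := fun y hy => by
    rw [uIcc_of_le hab] at hy; linarith [hy.1]
  have hc1 : ContinuousOn (fun y : ℝ => (logDeriv Gammaℝ (1 / 2 + y * I)).re) (uIcc a b) := by
    intro y _
    have hre : (0 : ℝ) < (1 / 2 + y * I : ℂ).re := by simp
    have h := continuousAt_logDeriv_of_analyticAt (analyticAt_Gammaℝ hre)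
      (Gammaℝ_ne_zero_of_re_pos hre)
    have h' : ContinuousAt (fun y : ℝ => (1 / 2 + y * I : ℂ)) y := by fun_prop
    exact (Complex.continuous_re.continuousAt.comp
      (ContinuousAt.comp (f := fun y : ℝ => (1 / 2 + y * I : ℂ)) h h')).continuousWithinAt
  have hc2 : ContinuousOn (fun y : ℝ => Real.log (y / (2 * π)) / 2 + 17 / 16 / y ^ 2)
      (uIcc a b) := by
    refine ContinuousOn.add (ContinuousOn.div_const (ContinuousOn.log (by fun_prop) ?_) _)
      (ContinuousOn.div (by fun_prop) (by fun_prop) ?_)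
    · intro y hy; have := hpos y hy; positivity
    · intro y hy; have := hpos y hy; positivity
  have hle := intervalIntegral.integral_mono_on (μ := volume) hab hc1.intervalIntegrable hc2.intervalIntegrable
    (fun y hy => re_logDeriv_Gammaℝ_half_le (hpos y (by rwa [uIcc_of_le hab])))
  have hF := intervalIntegral.integral_eq_sub_of_hasDerivAt
    (f := fun y => π * riemannVonMangoldtMain y - 17 / 16 * y⁻¹)
    (f' := fun y : ℝ => Real.log (y / (2 * π)) / 2 + 17 / 16 / y ^ 2) (a := a) (b := b)
    (fun y hy => by
      have hy0 := hpos y hy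
      refine (((hasDerivAt_riemannVonMangoldtMain hy0).const_mul π).sub
        ((hasDerivAt_inv hy0.ne').const_mul (17 / 16))).congr_deriv ?_
      field_simp
      ring) hc2.intervalIntegrable
  rw [hF] at hle
  have hb : 0 < b⁻¹ := by have : 0 < b := by linarith
                          positivity
  have ha' : a⁻¹ ≤ 17⁻¹ := by gcongr
  have hpi' := Real.pi_gt_three
  have h3 : 1 / π * (∫ y in a..b, (logDeriv Gammaℝ (1 / 2 + y * I)).re) ≤
      1 / π * (π * riemannVonMangoldtMain b - π * riemannVonMangoldtMain a + 1 / 16) := by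
    gcongr
    linarith
  have h4 : (1 / π) * (1 / 16) ≤ 1 / 3.14 * (1 / 16) := by
    have := Real.pi_gt_d2
    gcongr
  have h5 : 1 / π * (π * riemannVonMangoldtMain b - π * riemannVonMangoldtMain a + 1 / 16) =
      riemannVonMangoldtMain b - riemannVonMangoldtMain a + (1 / π) * (1 / 16) := by
    field_simp
  rw [h5] at h3
  norm_num at h4 h3 ⊢
  linarith

/-- The number of zeros with `T ≤ Im ρ < y`, for `y` not the ordinate of a zero. -/
theorem card_riemannZeta_zeros_Ico_le {T y : ℝ} (hT : 17 < T) (hTy : T < y)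
    (hy : y ∉ Complex.im '' riemannZetaZeros) {Z : Finset ℂ}
    (hZ : ∀ ρ ∈ Z, riemannZeta ρ = 0 ∧ 0 < ρ.re ∧ ρ.re < 1 ∧ T ≤ ρ.im ∧ ρ.im < y) :
    (Z.card : ℝ) ≤ riemannVonMangoldtMain y - riemannVonMangoldtMain T +
      1.5 * Real.log T + 1.5 * Real.log y + 4.24 := by
  have hnhds : ∀ᶠ u in 𝓝 T, riemannVonMangoldtMain T - 0.02 < riemannVonMangoldtMain u :=
    (hasDerivAt_riemannVonMangoldtMain (by linarith)).continuousAt.eventually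
      (lt_mem_nhds (by linarith))
  obtain ⟨l, hl, hlT⟩ := exists_Ioc_subset_of_mem_nhds hnhds ⟨17, hT⟩
  obtain ⟨S, hS, h1, h2⟩ := (countable_im_riemannZetaZeros.dense_compl ℝ).exists_between
    (max_lt hT hl : max 17 l < T)
  have hS17 : 17 ≤ S := (le_max_left _ _).trans h1.le
  have hmain : riemannVonMangoldtMain T - 0.02 < riemannVonMangoldtMain S :=
    hlT ⟨(le_max_right _ _).trans_lt h1, h2.le⟩
  have hcard := card_riemannZeta_zeros_le hS17 (h2.trans hTy)
    (riemannZeta_ne_zero_of_im_notMem hS) (riemannZeta_ne_zero_of_im_notMem hy)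
    (fun ρ hρ => have h := hZ ρ hρ
      ⟨h.1, h.2.1, h.2.2.1, h2.trans_le h.2.2.2.1, h.2.2.2.2⟩)
  have hint := integral_re_logDeriv_Gammaℝ_half_le hS17 (h2.trans hTy).le
  have hlog : Real.log S ≤ Real.log T := Real.log_le_log (by linarith) h2.le
  linarith

/-- Abel summation against an upper bound `B` for the counting function of `γ` on `Z`. -/
theorem sum_le_add_integral_mul_deriv {ι : Type*} (Z : Finset ι) (γ : ι → ℝ) {a Y : ℝ}
    (haY : a ≤ Y) {f f' B B' : ℝ → ℝ} (hγ : ∀ i ∈ Z, a ≤ γ i ∧ γ i ≤ Y)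
    (hf : ∀ x ∈ Icc a Y, HasDerivAt f (f' x) x) (hB : ∀ x ∈ Icc a Y, HasDerivAt B (B' x) x)
    (hf'c : ContinuousOn f' (Icc a Y)) (hB'c : ContinuousOn B' (Icc a Y))
    (hf' : ∀ x ∈ Icc a Y, f' x ≤ 0) (hfY : 0 ≤ f Y)
    (hcard : ∀ᵐ y, y ∈ Ioc a Y → ((Z.filter (γ · < y)).card : ℝ) ≤ B y)
    (hcardY : (Z.card : ℝ) ≤ B Y) :
    ∑ i ∈ Z, f (γ i) ≤ f a * B a + ∫ x in a..Y, f x * B' x := by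
  have hfi : IntegrableOn f' (Ioc a Y) :=
    (hf'c.integrableOn_compact isCompact_Icc).mono_set Ioc_subset_Icc_self
  have hfc : ContinuousOn f (Icc a Y) := fun x hx => (hf x hx).continuousAt.continuousWithinAt
  have hBc : ContinuousOn B (Icc a Y) := fun x hx => (hB x hx).continuousAt.continuousWithinAt
  have hfi' : IntegrableOn (fun x => - f' x) (Ioc a Y) := hfi.neg
  have hrep : ∀ i ∈ Z, f (γ i) = f Y + ∫ x in Ioc a Y, (Ioi (γ i)).indicator (fun x => - f' x) x := by
    intro i hi
    have hsub : Icc (γ i) Y ⊆ Icc a Y := Icc_subset_Icc_left (hγ i hi).1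
    rw [setIntegral_indicator measurableSet_Ioi, Ioc_inter_Ioi, max_eq_right (hγ i hi).1,
      ← intervalIntegral.integral_of_le (hγ i hi).2, intervalIntegral.integral_neg,
      intervalIntegral.integral_eq_sub_of_hasDerivAt (f := f)]
    · ring
    · intro x hx
      rw [uIcc_of_le (hγ i hi).2] at hx
      exact hf x (hsub hx)
    · exact (hf'c.mono (by rwa [uIcc_of_le (hγ i hi).2])).intervalIntegrable
  have hind : ∀ i ∈ Z, IntegrableOn ((Ioi (γ i)).indicator fun x => - f' x) (Ioc a Y) :=
    fun i _ => Integrable.indicator hfi' measurableSet_Ioi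
  have hBi : IntegrableOn (fun x => - f' x * B x) (Ioc a Y) :=
    ((hf'c.neg.mul hBc).integrableOn_compact isCompact_Icc).mono_set Ioc_subset_Icc_self
  have hsum : ∑ i ∈ Z, f (γ i) = Z.card * f Y +
      ∫ x in Ioc a Y, ∑ i ∈ Z, (Ioi (γ i)).indicator (fun x => - f' x) x := by
    rw [Finset.sum_congr rfl hrep, Finset.sum_add_distrib, integral_finsetSum Z hind]
    simp
  have hmono : ∫ x in Ioc a Y, ∑ i ∈ Z, (Ioi (γ i)).indicator (fun x => - f' x) x ≤
      ∫ x in Ioc a Y, - f' x * B x := by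
    refine setIntegral_mono_on_ae (integrable_finsetSum Z hind) hBi measurableSet_Ioc ?_
    filter_upwards [hcard] with x hx hxI
    have h1 : ∑ i ∈ Z, (Ioi (γ i)).indicator (fun x => - f' x) x =
        - f' x * ((Z.filter (γ · < x)).card : ℝ) := by
      simp only [indicator_apply, mem_Ioi]
      rw [← Finset.sum_filter, Finset.sum_const, nsmul_eq_mul, mul_comm]
    rw [h1]
    exact mul_le_mul_of_nonneg_left (hx hxI)
      (neg_nonneg.2 (hf' x (Ioc_subset_Icc_self hxI)))
  have hu : uIcc a Y = Icc a Y := uIcc_of_le haY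
  have hparts := intervalIntegral.integral_mul_deriv_eq_deriv_mul (a := a) (b := Y) (u := f)
    (v := B) (u' := f') (v' := B') (by rwa [hu]) (by rwa [hu])
    (hf'c.mono hu.le).intervalIntegrable (hB'c.mono hu.le).intervalIntegrable
  have hneg : ∫ x in Ioc a Y, - f' x * B x = - ∫ x in a..Y, f' x * B x := by
    rw [intervalIntegral.integral_of_le haY, ← integral_neg]
    simp
  rw [hsum]
  have := mul_le_mul_of_nonneg_right hcardY hfY
  linarith

theorem integrableOn_log_mul_inv_sq_add {t t0 : ℝ} (ht : 0 < t) (ht0 : 2 * π ≤ t0) :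
    IntegrableOn (fun x : ℝ => Real.log ((x + t) / (2 * π)) * (1 / x ^ 2 + 1 / (x + 2 * t) ^ 2))
      (Ioi t0) := by
  have hpi := Real.pi_gt_three
  have h0 : (0 : ℝ) < t0 := by linarith
  have hint : IntegrableOn (fun x : ℝ => 4 * x ^ (-(3 / 2) : ℝ) +
      2 * Real.log (1 + t) * x ^ (-2 : ℝ)) (Ioi t0) :=
    ((integrableOn_Ioi_rpow_of_lt (by norm_num) h0).const_mul _).add
      ((integrableOn_Ioi_rpow_of_lt (by norm_num) h0).const_mul _)
  refine Integrable.mono' hint (by fun_prop) ?_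
  filter_upwards [ae_restrict_mem measurableSet_Ioi] with x hx
  have hx0 : t0 < x := hx
  have hx1 : 0 < x := h0.trans hx0
  have hlog0 : 0 ≤ Real.log ((x + t) / (2 * π)) :=
    Real.log_nonneg (by rw [one_le_div (by positivity)]; linarith)
  have hlog : Real.log ((x + t) / (2 * π)) ≤ 2 * x ^ (1 / 2 : ℝ) + Real.log (1 + t) := by
    have h1 : (x + t) / (2 * π) ≤ x * (1 + t) := by
      rw [div_le_iff₀ (by positivity)]
      nlinarith [mul_pos hx1 ht]
    have h2 := Real.log_le_log (by positivity) h1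
    rw [Real.log_mul hx1.ne' (by positivity)] at h2
    have h3 := Real.log_le_rpow_div hx1.le (by norm_num : (0 : ℝ) < 1 / 2)
    linarith
  have hf : 1 / x ^ 2 + 1 / (x + 2 * t) ^ 2 ≤ 2 * x ^ (-2 : ℝ) := by
    have h1 : 1 / (x + 2 * t) ^ 2 ≤ 1 / x ^ 2 := by gcongr; linarith
    have h2 : x ^ (-2 : ℝ) = 1 / x ^ 2 := by
      rw [Real.rpow_neg hx1.le, Real.rpow_ofNat, one_div]
    linarith
  rw [Real.norm_of_nonneg (mul_nonneg hlog0 (by positivity))]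
  refine (mul_le_mul hlog hf (by positivity) (hlog0.trans hlog)).trans_eq ?_
  have h3 : x ^ (-(3 / 2) : ℝ) = x ^ (1 / 2 : ℝ) * x ^ (-2 : ℝ) := by
    rw [← Real.rpow_add hx1]
    norm_num
  rw [h3]
  ring

theorem le_log_of_two_pi_exp_lt {x : ℝ} (hx : 2 * π * Real.exp 1 < x) : 2.829 ≤ Real.log x := by
  have hpi := Real.pi_pos
  have h1 : Real.log (2 * π * Real.exp 1) ≤ Real.log x := Real.log_le_log (by positivity) hx.le
  have h2 : Real.log (2 * π * Real.exp 1) =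
      Real.log 2 + Real.log 2 + Real.log (1 + (π / 2 - 1)) + 1 := by
    rw [Real.log_mul (by positivity) (by positivity), Real.log_exp,
      ← Real.log_mul (by norm_num) (by norm_num), ← Real.log_mul (by norm_num) (by linarith)]
    congr 2
    ring
  have h3 : 0.57 ≤ π / 2 - 1 := by linarith [Real.pi_gt_d2]
  have h4 : Real.log (1 + 0.57) ≤ Real.log (1 + (π / 2 - 1)) :=
    Real.log_le_log (by norm_num) (by linarith)
  have h5 := Real.le_log_one_add_of_nonneg (x := 0.57) (by norm_num)
  have h6 := Real.log_two_gt_d9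
  norm_num at *
  linarith

theorem inv_sq_add_inv_sq_mul_sub_log_le {t t0 : ℝ} (ht : 0 < t)
    (ht0 : 2 * π * Real.exp 1 < t0) :
    (1 / t0 ^ 2 + 1 / (t0 + 2 * t) ^ 2) * (4.24 - Real.log (t + t0)) ≤ 1 / (t * t0) := by
  have h0 : 0 < t0 := lt_trans (by positivity) ht0
  have hlog0 := le_log_of_two_pi_exp_lt ht0
  obtain ⟨w, hw, rfl⟩ : ∃ w, 0 < w ∧ t = w * t0 := ⟨t / t0, by positivity, by field_simp⟩
  have h1 : Real.log (w * t0 + t0) = Real.log t0 + Real.log (1 + w) := by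
    rw [← Real.log_mul h0.ne' (by positivity)]
    ring_nf
  have h2 := Real.le_log_one_add_of_nonneg hw.le
  have h3 : (1 / t0 ^ 2 + 1 / (t0 + 2 * (w * t0)) ^ 2) * (4.24 - Real.log (w * t0 + t0)) ≤
      (1 / t0 ^ 2 + 1 / (t0 + 2 * (w * t0)) ^ 2) * (1.411 - 2 * w / (w + 2)) := by
    refine mul_le_mul_of_nonneg_left ?_ (by positivity)
    linarith
  refine h3.trans ?_
  rw [← sub_nonneg]
  have h4 : 1 / (w * t0 * t0) - (1 / t0 ^ 2 + 1 / (t0 + 2 * (w * t0)) ^ 2) *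
      (1.411 - 2 * w / (w + 2)) = (2 + 3.356 * w + 1.89 * w ^ 2 - 4.932 * w ^ 3 + 2.356 * w ^ 4) /
        (w * t0 ^ 2 * (w + 2) * (1 + 2 * w) ^ 2) := by
    have : t0 + 2 * (w * t0) = t0 * (1 + 2 * w) := by ring
    rw [this]
    field_simp
    ring
  rw [h4]
  have h5 : 0 ≤ 2 + 3.356 * w + 1.89 * w ^ 2 - 4.932 * w ^ 3 + 2.356 * w ^ 4 := by
    nlinarith [sq_nonneg (w ^ 2 - 1.1 * w), sq_nonneg (w - 1), mul_pos hw hw,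
      sq_nonneg (w ^ 2 - w - 1)]
  positivity

theorem sum_riemannZeta_zeros_le {t t0 : ℝ} (ht : 0 < t) (ht0 : 2 * π * Real.exp 1 < t0)
    {Z : Finset ℂ}
    (hZ : ∀ ρ ∈ Z, riemannZeta ρ = 0 ∧ 0 < ρ.re ∧ ρ.re < 1 ∧ t + t0 ≤ ρ.im) :
    ∑ ρ ∈ Z, (1 / (ρ.im - t) ^ 2 + 1 / (ρ.im + t) ^ 2) ≤
      (1 / (2 * π)) * (∫ x in Ioi t0,
          Real.log ((x + t) / (2 * π)) * (1 / x ^ 2 + 1 / (x + 2 * t) ^ 2)) +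
        4 * Real.log (t + t0) * (1 / t0 ^ 2 + 1 / (t0 + 2 * t) ^ 2) + 4 / (t * t0) := by
  have hpi := Real.pi_pos
  have h17 : 17 < t0 := by
    have := Real.pi_gt_d2
    have := Real.exp_one_gt_d9
    nlinarith
  have h0 : 0 < t0 := by linarith
  have h2pi : 2 * π < t0 := by
    have := Real.pi_lt_d2
    linarith
  have hfun : (fun ρ : ℂ => 1 / (ρ.im - t) ^ 2 + 1 / (ρ.im + t) ^ 2) =
      fun ρ : ℂ => (fun x : ℝ => 1 / x ^ 2 + 1 / (x + 2 * t) ^ 2) (ρ.im - t) := by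
    ext ρ
    ring_nf
  set f : ℝ → ℝ := fun x => 1 / x ^ 2 + 1 / (x + 2 * t) ^ 2 with hfdef
  obtain ⟨M, hM⟩ : ∃ M : ℝ, ∀ ρ ∈ Z, ρ.im ≤ M := by
    obtain ⟨M, hM⟩ := (Z.image Complex.im).bddAbove
    exact ⟨M, fun ρ hρ => hM (by simpa using ⟨ρ, hρ, rfl⟩)⟩
  obtain ⟨U, hU, h1, -⟩ := (countable_im_riemannZetaZeros.dense_compl ℝ).exists_between
    (lt_add_one (max M (t + t0)))
  have hMU : M < U := (le_max_left _ _).trans_lt h1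
  have hTU : t + t0 < U := (le_max_right _ _).trans_lt h1
  have hcount : ∀ u ∉ Complex.im '' riemannZetaZeros, t + t0 < u → ∀ W ⊆ Z,
      (∀ ρ ∈ W, ρ.im < u) → (W.card : ℝ) ≤ riemannVonMangoldtMain u -
        riemannVonMangoldtMain (t + t0) + 1.5 * Real.log (t + t0) + 1.5 * Real.log u + 4.24 :=
    fun u hu hTu W hWZ hW => card_riemannZeta_zeros_Ico_le (by linarith) hTu hu fun ρ hρ =>
      have h := hZ ρ (hWZ hρ)
      ⟨h.1, h.2.1, h.2.2.1, h.2.2.2, hW ρ hρ⟩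
  have hfd : ∀ x ∈ Icc t0 (U - t), HasDerivAt f (-2 / x ^ 3 + -2 / (x + 2 * t) ^ 3) x := by
    intro x hx
    have hx0 : 0 < x := h0.trans_le hx.1
    have hd : ∀ y : ℝ, 0 < y → HasDerivAt (fun y : ℝ => 1 / y ^ 2) (-2 / y ^ 3) y := by
      intro y hy
      refine ((hasDerivAt_const y (1 : ℝ)).div (hasDerivAt_pow 2 y) (by positivity)).congr_deriv ?_
      field_simp
      ring
    exact (hd x hx0).add ((hd (x + 2 * t) (by positivity)).comp_add_const x (2 * t))
  have hBd : ∀ x ∈ Icc t0 (U - t), HasDerivAt (fun x => riemannVonMangoldtMain (x + t) -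
        riemannVonMangoldtMain (t + t0) + 1.5 * Real.log (t + t0) + 1.5 * Real.log (x + t) + 4.24)
      (Real.log ((x + t) / (2 * π)) / (2 * π) + 1.5 * (x + t)⁻¹) x := by
    intro x hx
    have hx0 : 0 < x + t := by linarith [hx.1]
    exact (((((hasDerivAt_riemannVonMangoldtMain hx0).comp_add_const x t).sub_const _).add_const
      _).add (((Real.hasDerivAt_log hx0.ne').comp_add_const x t).const_mul 1.5)).add_const _
  have hBc : ContinuousOn (fun x => Real.log ((x + t) / (2 * π)) / (2 * π) + 1.5 * (x + t)⁻¹)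
      (Icc t0 (U - t)) := by
    refine ContinuousOn.add (ContinuousOn.div_const (ContinuousOn.log (by fun_prop) ?_) _)
      (ContinuousOn.mul (by fun_prop) (ContinuousOn.inv₀ (by fun_prop) ?_))
    · intro x hx
      have : 0 < x + t := by linarith [hx.1]
      positivity
    · intro x hx
      linarith [hx.1]
  have hYt : t0 ≤ U - t := by linarith
  have habel := sum_le_add_integral_mul_deriv Z (fun ρ => ρ.im - t) (a := t0) (Y := U - t)
    hYt (f := f) (fun ρ hρ => ⟨by linarith [(hZ ρ hρ).2.2.2], by linarith [hM ρ hρ]⟩) hfd hBd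
    (by
      refine ContinuousOn.add (ContinuousOn.div (by fun_prop) (by fun_prop) ?_)
        (ContinuousOn.div (by fun_prop) (by fun_prop) ?_)
      · intro x hx
        have : 0 < x := by linarith [hx.1]
        positivity
      · intro x hx
        have : 0 < x := by linarith [hx.1]
        positivity)
    hBc
    (by
      intro x hx
      have : 0 < x := by linarith [hx.1]
      have h1 : 0 ≤ 2 / x ^ 3 := by positivity
      have h2 : 0 ≤ 2 / (x + 2 * t) ^ 3 := by positivity
      rw [neg_div, neg_div]
      linarith)
    (by positivity)
    (by
      have hc : ((fun x : ℝ => x + t) ⁻¹' (Complex.im '' riemannZetaZeros)).Countable :=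
        countable_im_riemannZetaZeros.preimage_of_injOn (add_left_injective t).injOn
      filter_upwards [hc.ae_notMem volume] with y hy hyI
      refine hcount (y + t) hy (by linarith [hyI.1]) _ (Finset.filter_subset _ _) fun ρ hρ => ?_
      have := (Finset.mem_filter.1 hρ).2
      linarith)
    (by
      refine hcount (U - t + t) (by simpa using hU) (by linarith) Z subset_rfl fun ρ hρ => ?_
      linarith [hM ρ hρ])
  have hfc : ContinuousOn f (Icc t0 (U - t)) :=
    fun x hx => (hfd x hx).continuousAt.continuousWithinAt
  have hmain := integrableOn_log_mul_inv_sq_add ht h2pi.le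
  have hu : uIcc t0 (U - t) = Icc t0 (U - t) := uIcc_of_le hYt
  have hi1 : IntervalIntegrable (fun x : ℝ => 1 / (2 * π) * (Real.log ((x + t) / (2 * π)) * f x))
      volume t0 (U - t) :=
    (((intervalIntegrable_iff_integrableOn_Ioc_of_le hYt).2
      (hmain.mono_set Ioc_subset_Ioi_self)).const_mul _)
  have hi2 : IntervalIntegrable (fun x : ℝ => 1.5 / t * f x) volume t0 (U - t) :=
    ((hfc.mono hu.le).intervalIntegrable).const_mul _
  have hle1 : ∫ x in t0..(U - t), f x *
      (Real.log ((x + t) / (2 * π)) / (2 * π) + 1.5 * (x + t)⁻¹) ≤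
      ∫ x in t0..(U - t), (1 / (2 * π) * (Real.log ((x + t) / (2 * π)) * f x) + 1.5 / t * f x) := by
    refine intervalIntegral.integral_mono_on hYt
      (((hfc.mul hBc).mono hu.le).intervalIntegrable) (hi1.add hi2) fun x hx => ?_
    have hx0 : 0 < x := by linarith [hx.1]
    have hfx : 0 ≤ f x := by positivity
    have h : (x + t)⁻¹ ≤ t⁻¹ := by gcongr; linarith
    have h' := mul_le_mul_of_nonneg_left h hfx
    have e1 : f x * (Real.log ((x + t) / (2 * π)) / (2 * π) + 1.5 * (x + t)⁻¹) =
      1 / (2 * π) * (Real.log ((x + t) / (2 * π)) * f x) + 1.5 * (f x * (x + t)⁻¹) := by ring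
    have e2 : 1.5 / t * f x = 1.5 * (f x * t⁻¹) := by ring
    rw [e1, e2]
    linarith
  rw [intervalIntegral.integral_add hi1 hi2, intervalIntegral.integral_const_mul,
    intervalIntegral.integral_const_mul] at hle1
  have hle2 : ∫ x in t0..(U - t), Real.log ((x + t) / (2 * π)) * f x ≤
      ∫ x in Ioi t0, Real.log ((x + t) / (2 * π)) * f x := by
    rw [intervalIntegral.integral_of_le hYt]
    refine setIntegral_mono_set hmain ?_ Ioc_subset_Ioi_self.eventuallyLE
    filter_upwards [ae_restrict_mem measurableSet_Ioi] with x hx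
    have hx0 : t0 < x := hx
    refine mul_nonneg (Real.log_nonneg ?_) (by positivity)
    rw [one_le_div (by positivity)]
    linarith
  have hle3 : ∫ x in t0..(U - t), f x ≤ 2 / t0 := by
    rw [intervalIntegral.integral_eq_sub_of_hasDerivAt (f := fun x => - x⁻¹ - (x + 2 * t)⁻¹)
      (f' := f) ?_ (hfc.mono hu.le).intervalIntegrable]
    · have hY0 : 0 < U - t := by linarith
      have h1 : 0 < (U - t)⁻¹ := by positivity
      have h2 : 0 < (U - t + 2 * t)⁻¹ := by positivity
      have h3 : (t0 + 2 * t)⁻¹ ≤ t0⁻¹ := by gcongr; linarith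
      rw [div_eq_mul_inv]
      linarith
    · intro x hx
      rw [hu] at hx
      have hx0 : 0 < x := by linarith [hx.1]
      refine ((hasDerivAt_inv hx0.ne').neg.sub
        ((hasDerivAt_inv (by positivity : x + 2 * t ≠ 0)).comp_add_const x (2 * t))).congr_deriv ?_
      simp only [hfdef]
      field_simp
      ring
  have hle4 := mul_le_mul_of_nonneg_left hle2 (by positivity : 0 ≤ 1 / (2 * π))
  have hle5 := mul_le_mul_of_nonneg_left hle3 (by positivity : 0 ≤ 1.5 / t)
  have hle6 := inv_sq_add_inv_sq_mul_sub_log_le ht ht0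
  have e5 : 1.5 / t * (2 / t0) = 3 * (1 / (t * t0)) := by
    field_simp
    norm_num
  have e6 : 4 / (t * t0) = 4 * (1 / (t * t0)) := by ring
  rw [Finset.sum_congr rfl fun ρ _ => congrFun hfun ρ]
  have e7 : f t0 * (riemannVonMangoldtMain (t0 + t) - riemannVonMangoldtMain (t + t0) +
      1.5 * Real.log (t + t0) + 1.5 * Real.log (t0 + t) + 4.24) =
      (1 / t0 ^ 2 + 1 / (t0 + 2 * t) ^ 2) * (4.24 - Real.log (t + t0)) +
      4 * Real.log (t + t0) * (1 / t0 ^ 2 + 1 / (t0 + 2 * t) ^ 2) := by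
    rw [add_comm t0 t]
    simp only [hfdef]
    ring
  rw [e7] at habel
  rw [e5] at hle5
  rw [e6]
  linarith

end

/-- Lehman-type bound: for `t > 0` and `t_0 > 2πe`, the sum of
`1/(Im ρ - t)² + 1/(Im ρ + t)²` over nontrivial zeros with `Im ρ ≥ t + t_0`
is bounded by an explicit integral expression. -/
theorem zeta_zero_sum_upper (t t0 : ℝ) (ht : 0 < t)
    (ht0 : 2 * Real.pi * Real.exp 1 < t0) :
    ∑' ρ : {ρ : ℂ // riemannZeta ρ = 0 ∧ 0 < ρ.re ∧ ρ.re < 1 ∧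
        t + t0 ≤ ρ.im},
          (1 / ((ρ : ℂ).im - t) ^ 2 + 1 / ((ρ : ℂ).im + t) ^ 2) ≤
      (1 / (2 * Real.pi)) *
          (∫ x in Set.Ioi t0,
            Real.log ((x + t) / (2 * Real.pi)) *
              (1 / x ^ 2 + 1 / (x + 2 * t) ^ 2)) +
        4 * Real.log (t + t0) * (1 / t0 ^ 2 + 1 / (t0 + 2 * t) ^ 2) +
        4 / (t * t0) := by
  refine Real.tsum_le_of_sum_le (fun ρ => by positivity) fun s => ?_
  have h := sum_riemannZeta_zeros_le ht ht0 (Z := s.map (Function.Embedding.subtype _))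
    (fun ρ hρ => by
      obtain ⟨ρ', -, rfl⟩ := Finset.mem_map.1 hρ
      exact ρ'.2)
  rw [Finset.sum_map] at h
  exact h
end

section
/- Set t* = 2.206 and c = 0.4629. Let a > 0, let 0 < ε < 1, and let b be a real number with b·(1−ε) ≥ t*. Let U_0 : ℝ → ℝ be a nonnegative measurable function such that t ↦ U_0(t)/(a² + (b−t)²) is integrable on ℝ and such that U_0(t) ≤ log|t| − c for all |t| ≥ t*. Then ∫_{−∞}^{∞} U_0(t)/(a² + (b−t)²) dt ≤ ∫_{−t*}^{−1/2} U_0(t)/(a² + (b−t)²) dt + ∫_{−1/2}^{1/2} U_0(t)/(a² + (b−t)²) dt + ∫_{1/2}^{t*} U_0(t)/(a² + (b−t)²) dt + (π/a)·log(b(1+ε)) + (1/b)·( 2·(log b)/ε + (1 + 1/ε)·log(1+ε) − (1 − 1/ε)·log(1−ε) + log((b+t*)/(b−t*)) ) − (t*·log t*/b)·( 1/(b+t*) + 1/(b−t*) ) − c·( 1/(b+t*) + (1/a)·( arctan((b−t*)/a) + π/2 ) ). -/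
open MeasureTheory

/-- A primitive of `log t / (t - d) ^ 2`. -/
noncomputable def logPrimitive (d t : ℝ) : ℝ :=
  -(Real.log t / (t - d)) + 1 / d * (Real.log (t - d) - Real.log t)

lemma hasDerivAt_logPrimitive {d t : ℝ} (hd : d ≠ 0) (ht : t ≠ 0) (htd : t - d ≠ 0) :
    HasDerivAt (logPrimitive d) (Real.log t / (t - d) ^ 2) t := by
  have h1 := Real.hasDerivAt_log ht
  have h2 : HasDerivAt (fun x : ℝ => x - d) 1 t := (hasDerivAt_id t).sub_const d
  have h3 := h2.log htd
  have h4 := (h1.div h2 htd).neg.add ((h3.sub h1).const_mul (1 / d))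
  refine h4.congr_deriv ?_
  field_simp
  ring

lemma tendsto_logPrimitive_atTop (d : ℝ) :
    Filter.Tendsto (logPrimitive d) Filter.atTop (nhds 0) := by
  have h0 : Filter.Tendsto (fun t : ℝ => 1 - d / t) Filter.atTop (nhds 1) := by
    simpa using (tendsto_const_nhds (x := (1 : ℝ))).sub
      ((tendsto_const_nhds (x := d)).div_atTop Filter.tendsto_id)
  have h1 : Filter.Tendsto (fun t : ℝ => Real.log t / t) Filter.atTop (nhds 0) :=
    Real.isLittleO_log_id_atTop.tendsto_div_nhds_zero
  have h2 := (h1.div h0 one_ne_zero).neg.add ((h0.log one_ne_zero).const_mul (1 / d))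
  simp only [Real.log_one, zero_div, neg_zero, mul_zero, add_zero] at h2
  refine h2.congr' ?_
  filter_upwards [Filter.eventually_gt_atTop 0, Filter.eventually_gt_atTop d] with t ht htd
  have hne : t - d ≠ 0 := by linarith
  have e : 1 - d / t = (t - d) / t := by field_simp
  simp only [logPrimitive, Pi.div_apply, e]
  rw [Real.log_div hne ht.ne']
  field_simp

lemma setIntegral_Ioi_le_logPrimitive {d q : ℝ} {h : ℝ → ℝ} (hd : d ≠ 0) (hq : 1 ≤ q)
    (hqd : d < q) (hh : IntegrableOn h (Set.Ioi q))
    (hle : ∀ t ∈ Set.Ioi q, h t ≤ Real.log t / (t - d) ^ 2) :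
    ∫ t in Set.Ioi q, h t ≤ -logPrimitive d q := by
  have hder : ∀ t ∈ Set.Ici q, HasDerivAt (logPrimitive d) (Real.log t / (t - d) ^ 2) t := by
    intro t ht
    have ht' : q ≤ t := ht
    exact hasDerivAt_logPrimitive hd (by linarith) (by linarith)
  have hpos : ∀ t ∈ Set.Ioi q, 0 ≤ Real.log t / (t - d) ^ 2 := by
    intro t ht
    have ht' : q < t := ht
    exact div_nonneg (Real.log_nonneg (by linarith)) (sq_nonneg _)
  have hlim := tendsto_logPrimitive_atTop d
  calc ∫ t in Set.Ioi q, h t ≤ ∫ t in Set.Ioi q, Real.log t / (t - d) ^ 2 :=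
        setIntegral_mono_on hh (integrableOn_Ioi_deriv_of_nonneg' hder hpos hlim)
          measurableSet_Ioi hle
    _ = -logPrimitive d q := by
        rw [integral_Ioi_of_hasDerivAt_of_nonneg' hder hpos hlim, zero_sub]

lemma intervalIntegral_le_logPrimitive {d T p : ℝ} {h : ℝ → ℝ} (hT : 0 < T) (hTp : T ≤ p)
    (hpd : p < d) (hh : IntervalIntegrable h volume T p)
    (hle : ∀ t ∈ Set.Icc T p, h t ≤ Real.log t / (t - d) ^ 2) :
    ∫ t in T..p, h t ≤ logPrimitive d p - logPrimitive d T := by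
  have hcont : ContinuousOn (fun t => Real.log t / (t - d) ^ 2) (Set.uIcc T p) := by
    rw [Set.uIcc_of_le hTp]
    intro t ht
    have h1 : t ≠ 0 := by linarith [ht.1]
    have h2 : (t - d) ^ 2 ≠ 0 := pow_ne_zero 2 (by linarith [ht.2])
    exact ((Real.continuousAt_log h1).div (by fun_prop) h2).continuousWithinAt
  have hint := hcont.intervalIntegrable (μ := volume)
  rw [← intervalIntegral.integral_eq_sub_of_hasDerivAt (f := logPrimitive d) _ hint]
  · exact intervalIntegral.integral_mono_on hTp hh hint hle
  · intro t ht
    rw [Set.uIcc_of_le hTp] at ht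
    exact hasDerivAt_logPrimitive (by linarith) (by linarith [ht.1]) (by linarith [ht.2])

lemma hasDerivAt_arctan_div {a : ℝ} (ha : 0 < a) (b t : ℝ) :
    HasDerivAt (fun x => 1 / a * Real.arctan ((x - b) / a)) (1 / (a ^ 2 + (b - t) ^ 2)) t := by
  have h := ((((hasDerivAt_id t).sub_const b).div_const a).arctan).const_mul (1 / a)
  refine h.congr_deriv ?_
  have h1 : a ^ 2 + (b - t) ^ 2 ≠ 0 := by positivity
  have h2 : 1 + ((t - b) / a) ^ 2 ≠ 0 := by positivity
  simp only [id]
  field_simp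
  ring

lemma tendsto_arctan_div_atTop {a : ℝ} (ha : 0 < a) (b : ℝ) :
    Filter.Tendsto (fun x => 1 / a * Real.arctan ((x - b) / a)) Filter.atTop
      (nhds (1 / a * (Real.pi / 2))) := by
  refine Filter.Tendsto.const_mul _ ?_
  refine (Real.tendsto_arctan_atTop.mono_right nhdsWithin_le_nhds).comp ?_
  exact (Filter.tendsto_atTop_add_const_right _ (-b) Filter.tendsto_id).atTop_div_const ha

lemma integrableOn_Ioi_poisson {a : ℝ} (ha : 0 < a) (b T : ℝ) :
    IntegrableOn (fun t => 1 / (a ^ 2 + (b - t) ^ 2)) (Set.Ioi T) :=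
  integrableOn_Ioi_deriv_of_nonneg' (fun t _ => hasDerivAt_arctan_div ha b t)
    (fun t _ => by positivity) (tendsto_arctan_div_atTop ha b)

lemma integral_Ioi_poisson {a : ℝ} (ha : 0 < a) (b T : ℝ) :
    ∫ t in Set.Ioi T, 1 / (a ^ 2 + (b - t) ^ 2) =
      1 / a * (Real.arctan ((b - T) / a) + Real.pi / 2) := by
  rw [integral_Ioi_of_hasDerivAt_of_nonneg' (fun t _ => hasDerivAt_arctan_div ha b t)
    (fun t _ => by positivity) (tendsto_arctan_div_atTop ha b)]
  rw [show (T - b) / a = -((b - T) / a) by ring, Real.arctan_neg]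
  ring

lemma intervalIntegral_poisson_le {a : ℝ} (ha : 0 < a) (b p q : ℝ) :
    ∫ t in p..q, 1 / (a ^ 2 + (b - t) ^ 2) ≤ Real.pi / a := by
  rw [← intervalIntegral.integral_Ioi_sub_Ioi' (integrableOn_Ioi_poisson ha b p)
    (integrableOn_Ioi_poisson ha b q), integral_Ioi_poisson ha, integral_Ioi_poisson ha,
    ← mul_sub, show Real.pi / a = 1 / a * Real.pi by ring]
  refine mul_le_mul_of_nonneg_left ?_ (by positivity)
  linarith [Real.arctan_lt_pi_div_two ((b - p) / a), Real.neg_pi_div_two_lt_arctan ((b - q) / a)]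

lemma integrableOn_and_integral_Ioi_inv_sq {b T : ℝ} (h : 0 < T + b) :
    IntegrableOn (fun t => 1 / (t + b) ^ 2) (Set.Ioi T) ∧
      ∫ t in Set.Ioi T, 1 / (t + b) ^ 2 = 1 / (b + T) := by
  have hder : ∀ t ∈ Set.Ici T, HasDerivAt (fun x => -(x + b)⁻¹) (1 / (t + b) ^ 2) t := by
    intro t ht
    have ht' : T ≤ t := ht
    have h0 : t + b ≠ 0 := by linarith
    have := (((hasDerivAt_id t).add_const b).inv h0).neg
    exact this.congr_deriv (by simp [neg_div])
  have hlim : Filter.Tendsto (fun x : ℝ => -(x + b)⁻¹) Filter.atTop (nhds 0) := by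
    have := (tendsto_inv_atTop_zero.comp
      (Filter.tendsto_atTop_add_const_right _ b (Filter.tendsto_id (α := ℝ)))).neg
    simpa using! this
  refine ⟨integrableOn_Ioi_deriv_of_nonneg' hder (fun t _ => by positivity) hlim, ?_⟩
  rw [integral_Ioi_of_hasDerivAt_of_nonneg' hder (fun t _ => by positivity) hlim]
  simp [add_comm]

lemma setIntegral_left_tail_le {a b c T : ℝ} (hb : 0 < b) (hT : 1 ≤ T)
    {U : ℝ → ℝ} (hU : ∀ t, 0 ≤ U t)
    (hint : Integrable (fun t => U t / (a ^ 2 + (b - t) ^ 2)))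
    (hUb : ∀ t : ℝ, T ≤ |t| → U t ≤ Real.log |t| - c) :
    ∫ t in Set.Iic (-T), U t / (a ^ 2 + (b - t) ^ 2) ≤
      -logPrimitive (-b) T - c * (1 / (b + T)) := by
  obtain ⟨hi, he⟩ := integrableOn_and_integral_Ioi_inv_sq (b := b) (T := T) (by linarith)
  have hi' := hi.const_mul c
  have hneg : IntegrableOn (fun t => U (-t) / (a ^ 2 + (b - -t) ^ 2)) (Set.Ioi T) :=
    hint.comp_neg.integrableOn
  have key := setIntegral_Ioi_le_logPrimitive (d := -b) (q := T) (by linarith) hT (by linarith)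
    (hneg.add hi') (by
      intro t ht
      have ht' : T < t := ht
      have h1 : U (-t) ≤ Real.log t - c := by
        have := hUb (-t) (by rw [abs_neg]; exact ht'.le.trans (le_abs_self t))
        rwa [abs_neg, abs_of_pos (by linarith)] at this
      have h2 : 0 < (t + b) ^ 2 := pow_pos (by linarith) 2
      have h3 : U (-t) / (a ^ 2 + (b - -t) ^ 2) ≤ (Real.log t - c) / (t + b) ^ 2 :=
        div_le_div₀ ((hU _).trans h1) h1 h2 (by nlinarith [sq_nonneg a])
      rw [sub_div] at h3
      rw [Pi.add_apply, mul_one_div, show t - -b = t + b by ring]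
      linarith)
  simp only [Pi.add_apply] at key
  rw [integral_add hneg hi', integral_const_mul, he,
    integral_comp_neg_Ioi T (fun t => U t / (a ^ 2 + (b - t) ^ 2))] at key
  linarith

lemma setIntegral_right_tail_le {a b c p q T : ℝ} (ha : 0 < a) (hT : 1 ≤ T)
    (hTp : T ≤ p) (hpb : p < b) (hbq : b < q) {U : ℝ → ℝ}
    (hint : Integrable (fun t => U t / (a ^ 2 + (b - t) ^ 2)))
    (hUb : ∀ t : ℝ, T ≤ |t| → U t ≤ Real.log |t| - c) :
    ∫ t in Set.Ioi T, U t / (a ^ 2 + (b - t) ^ 2) ≤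
      logPrimitive b p - logPrimitive b T - logPrimitive b q + Real.pi / a * Real.log q -
        c * (1 / a * (Real.arctan ((b - T) / a) + Real.pi / 2)) := by
  have hP := (integrableOn_Ioi_poisson ha b T)
  have hcP := hP.const_mul c
  have hf : IntegrableOn (fun t => U t / (a ^ 2 + (b - t) ^ 2)) (Set.Ioi T) := hint.integrableOn
  set h : ℝ → ℝ := fun t => U t / (a ^ 2 + (b - t) ^ 2) + c * (1 / (a ^ 2 + (b - t) ^ 2)) with hh
  have hhi : IntegrableOn h (Set.Ioi T) := hf.add hcP
  have hval : ∫ t in Set.Ioi T, h t = (∫ t in Set.Ioi T, U t / (a ^ 2 + (b - t) ^ 2)) +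
      c * (1 / a * (Real.arctan ((b - T) / a) + Real.pi / 2)) := by
    rw [hh, integral_add hf hcP, integral_const_mul, integral_Ioi_poisson ha]
  have hlog : ∀ t, T ≤ t → h t ≤ Real.log t * (1 / (a ^ 2 + (b - t) ^ 2)) := by
    intro t ht
    have h1 := hUb t (ht.trans (le_abs_self t))
    rw [abs_of_pos (by linarith)] at h1
    have h2 : 0 ≤ 1 / (a ^ 2 + (b - t) ^ 2) := by positivity
    have h3 := mul_le_mul_of_nonneg_right h1 h2
    simp only [hh]
    rw [div_eq_mul_one_div (U t)]
    linarith
  have hfar : ∀ t, T ≤ t → t ≠ b → h t ≤ Real.log t / (t - b) ^ 2 := by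
    intro t ht htb
    refine (hlog t ht).trans ?_
    rw [mul_one_div]
    have h2 : 0 < (t - b) ^ 2 := by
      have := sub_ne_zero.2 htb
      positivity
    exact div_le_div_of_nonneg_left (Real.log_nonneg (by linarith)) h2 (by nlinarith [sq_nonneg a])
  have hip : IntegrableOn h (Set.Ioi p) := hhi.mono_set (Set.Ioi_subset_Ioi hTp)
  have hiq : IntegrableOn h (Set.Ioi q) := hhi.mono_set (Set.Ioi_subset_Ioi (by linarith))
  have hTp_int : IntervalIntegrable h volume T p :=
    (intervalIntegrable_iff_integrableOn_Ioc_of_le hTp).2 (hhi.mono_set Set.Ioc_subset_Ioi_self)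
  have hpq_int : IntervalIntegrable h volume p q :=
    (intervalIntegrable_iff_integrableOn_Ioc_of_le (by linarith)).2
      (hip.mono_set Set.Ioc_subset_Ioi_self)
  have e1 := intervalIntegral.integral_interval_add_Ioi hhi hip
  have e2 := intervalIntegral.integral_interval_add_Ioi hip hiq
  have b1 := intervalIntegral_le_logPrimitive (by linarith) hTp hpb hTp_int
    (fun t ht => hfar t ht.1 (by linarith [ht.2]))
  have b3 := setIntegral_Ioi_le_logPrimitive (d := b) (by linarith) (by linarith) hbq hiq
    (fun t ht => hfar t (by linarith [Set.mem_Ioi.1 ht]) (by linarith [Set.mem_Ioi.1 ht]))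
  have b2 : ∫ t in p..q, h t ≤ Real.pi / a * Real.log q := by
    have hPint : IntervalIntegrable (fun t => 1 / (a ^ 2 + (b - t) ^ 2)) volume p q :=
      (intervalIntegrable_iff_integrableOn_Ioc_of_le (by linarith)).2
        ((integrableOn_Ioi_poisson ha b p).mono_set Set.Ioc_subset_Ioi_self)
    calc ∫ t in p..q, h t ≤ ∫ t in p..q, Real.log q * (1 / (a ^ 2 + (b - t) ^ 2)) := by
          refine intervalIntegral.integral_mono_on (by linarith) hpq_int
            (hPint.const_mul _) fun t ht => (hlog t (hTp.trans ht.1)).trans ?_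
          exact mul_le_mul_of_nonneg_right
            (Real.log_le_log (by linarith [ht.1]) ht.2) (by positivity)
      _ = Real.log q * ∫ t in p..q, 1 / (a ^ 2 + (b - t) ^ 2) :=
          intervalIntegral.integral_const_mul _ _
      _ ≤ Real.log q * (Real.pi / a) :=
          mul_le_mul_of_nonneg_left (intervalIntegral_poisson_le ha b p q)
            (Real.log_nonneg (by linarith))
      _ = Real.pi / a * Real.log q := mul_comm _ _
  linarith

lemma logPrimitive_sum_eq {b ε T : ℝ} (hT : 0 < T) (hTb : T < b) (hε0 : 0 < ε) (hε1 : ε < 1) :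
    -logPrimitive (-b) T +
      (logPrimitive b (b * (1 - ε)) - logPrimitive b T - logPrimitive b (b * (1 + ε))) =
    1 / b * (2 * Real.log b / ε + (1 + 1 / ε) * Real.log (1 + ε) -
      (1 - 1 / ε) * Real.log (1 - ε) + Real.log ((b + T) / (b - T))) -
      T * Real.log T / b * (1 / (b + T) + 1 / (b - T)) := by
  have hb : 0 < b := hT.trans hTb
  have h1 : 1 - ε ≠ 0 := by linarith
  have h2 : 1 + ε ≠ 0 := by linarith
  have h3 : b - T ≠ 0 := by linarith
  have h4 : b + T ≠ 0 := by linarith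
  have e1 : b * (1 - ε) - b = -(b * ε) := by ring
  have e2 : b * (1 + ε) - b = b * ε := by ring
  have e3 : T - b = -(b - T) := by ring
  have e4 : T - -b = b + T := by ring
  simp only [logPrimitive, e1, e2, e3, e4, Real.log_neg_eq_log]
  rw [Real.log_mul hb.ne' h1, Real.log_mul hb.ne' h2, Real.log_mul hb.ne' hε0.ne',
    Real.log_div h4 h3]
  field_simp
  ring

/-- With `t* = 2.206` and `c = 0.4629`: if `a > 0`, `0 < ε < 1`,
`b(1-ε) ≥ t*`, `U_0` is nonnegative, `t ↦ U_0(t)/(a² + (b-t)²)` is integrable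
on `ℝ`, and `U_0(t) ≤ log |t| - c` for `|t| ≥ t*`, then the integral of
`U_0(t)/(a² + (b-t)²)` over `ℝ` is bounded by the stated explicit
expression. -/
theorem U0_integral_bound (a ε b : ℝ) (ha : 0 < a) (hε0 : 0 < ε) (hε1 : ε < 1)
    (hb : 2.206 ≤ b * (1 - ε)) (U0 : ℝ → ℝ) (hU0 : ∀ t, 0 ≤ U0 t)
    (hint : Integrable (fun t => U0 t / (a ^ 2 + (b - t) ^ 2)))
    (hUb : ∀ t : ℝ, 2.206 ≤ |t| → U0 t ≤ Real.log |t| - 0.4629) :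
    ∫ t, U0 t / (a ^ 2 + (b - t) ^ 2) ≤
      (∫ t in (-2.206 : ℝ)..(-(1 / 2)), U0 t / (a ^ 2 + (b - t) ^ 2)) +
        (∫ t in (-(1 / 2) : ℝ)..(1 / 2), U0 t / (a ^ 2 + (b - t) ^ 2)) +
        (∫ t in (1 / 2 : ℝ)..2.206, U0 t / (a ^ 2 + (b - t) ^ 2)) +
        Real.pi / a * Real.log (b * (1 + ε)) +
        (1 / b) * (2 * Real.log b / ε + (1 + 1 / ε) * Real.log (1 + ε) -
          (1 - 1 / ε) * Real.log (1 - ε) +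
          Real.log ((b + 2.206) / (b - 2.206))) -
        (2.206 * Real.log 2.206 / b) * (1 / (b + 2.206) + 1 / (b - 2.206)) -
        0.4629 * (1 / (b + 2.206) +
          (1 / a) * (Real.arctan ((b - 2.206) / a) + Real.pi / 2)) := by
  have hb0 : 0 < b := by nlinarith
  have hbp : b * (1 - ε) < b := by nlinarith
  have hbq : b < b * (1 + ε) := by nlinarith
  have hL := setIntegral_left_tail_le hb0 (by norm_num) hU0 hint hUb
  have hR := setIntegral_right_tail_le ha (by norm_num) hb hbp hbq hint hUb
  have hE := logPrimitive_sum_eq (b := b) (T := 2.206) (by norm_num) (by linarith) hε0 hε1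
  have s1 := intervalIntegral.integral_Iic_add_Ioi (b := (-2.206 : ℝ)) hint.integrableOn
    hint.integrableOn
  have s2 := intervalIntegral.integral_interval_add_Ioi (a := (-2.206 : ℝ)) (b := 2.206)
    hint.integrableOn hint.integrableOn
  have s3 := intervalIntegral.integral_add_adjacent_intervals (a := (-2.206 : ℝ))
    (b := -(1 / 2)) (c := 1 / 2) hint.intervalIntegrable hint.intervalIntegrable
  have s4 := intervalIntegral.integral_add_adjacent_intervals (a := (-2.206 : ℝ))
    (b := 1 / 2) (c := 2.206) hint.intervalIntegrable hint.intervalIntegrable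
  rw [mul_add (0.4629 : ℝ)]
  linarith
end

section
/- Let b > 0 and ε > 0 be real numbers. Then ∫_{b(1+ε)}^{∞} (log t)/(b−t)² dt = (1/(b·ε))·( log b + ε·log(1 + 1/ε) + log(1+ε) ). -/
open Filter Topology in
theorem tendsto_neg_log_sub_div_add_log_sub_log_atTop (b c : ℝ) :
    Tendsto (fun t : ℝ => -(Real.log t - c) / (t - b) + (1 / b) * (Real.log (t - b) - Real.log t))
      atTop (𝓝 0) := by
  have h₁ := Real.tendsto_pow_log_div_mul_add_atTop 1 (-b) 1 one_ne_zero
  have h₂ := Real.tendsto_pow_log_div_mul_add_atTop 1 (-b) 0 one_ne_zero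
  have h₃ := Real.tendsto_log_comp_add_sub_log (-b)
  have h := (h₁.neg.add (h₂.const_mul c)).add (h₃.const_mul (1 / b))
  simp only [mul_zero, neg_zero, add_zero] at h
  refine h.congr fun t => ?_
  simp only [pow_one, pow_zero, one_mul, ← sub_eq_add_neg]
  ring

theorem hasDerivAt_neg_log_sub_div_add_log_sub_log {b t : ℝ} (c : ℝ) (hb : 0 < b) (ht : b < t) :
    HasDerivAt
      (fun t : ℝ => -(Real.log t - c) / (t - b) + (1 / b) * (Real.log (t - b) - Real.log t))
      ((Real.log t - c) / (b - t) ^ 2) t := by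
  have ht₀ : t ≠ 0 := (hb.trans ht).ne'
  have htb : t - b ≠ 0 := (sub_pos.2 ht).ne'
  have hbt : b - t ≠ 0 := (sub_neg.2 ht).ne
  have hlog := Real.hasDerivAt_log ht₀
  have hsub := (hasDerivAt_id t).sub_const b
  have h := ((hlog.sub_const c).neg.div hsub htb).add
    (((hsub.log htb).sub hlog).const_mul (1 / b))
  refine h.congr_deriv ?_
  rw [← neg_sub t b, neg_sq]
  simp only [id, Pi.neg_apply]
  field_simp
  ring

open MeasureTheory Set Filter Topology in
theorem integrableOn_Ioi_one_div_sub_sq {a b : ℝ} (hab : b < a) :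
    IntegrableOn (fun t : ℝ => 1 / (b - t) ^ 2) (Ioi a) := by
  have hlim : Tendsto (fun t : ℝ => (b - t)⁻¹) atTop (𝓝 0) :=
    tendsto_inv_atBot_zero.comp (tendsto_atBot_add_const_left _ b tendsto_neg_atTop_atBot)
  refine integrableOn_Ioi_deriv_of_nonneg' (fun t ht => ?_) (fun t _ => by positivity) hlim
  have hbt : b - t ≠ 0 := (sub_neg.2 (hab.trans_le ht)).ne
  exact (((hasDerivAt_id t).const_sub b).inv hbt).congr_deriv (by simp)

open MeasureTheory Set in
theorem integrableOn_Ioi_log_div_sub_sq {a b : ℝ} (hb : 0 < b) (hab : b < a) :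
    IntegrableOn (fun t : ℝ => Real.log t / (b - t) ^ 2) (Ioi a) := by
  have h : IntegrableOn (fun t : ℝ => (Real.log t - Real.log b) / (b - t) ^ 2) (Ioi a) :=
    integrableOn_Ioi_deriv_of_nonneg'
      (fun t ht => hasDerivAt_neg_log_sub_div_add_log_sub_log _ hb (hab.trans_le ht))
      (fun t ht => div_nonneg (sub_nonneg.2 (Real.log_le_log hb (hab.trans ht).le)) (sq_nonneg _))
      (tendsto_neg_log_sub_div_add_log_sub_log_atTop b _)
  refine (h.add ((integrableOn_Ioi_one_div_sub_sq hab).const_mul (Real.log b))).congr_fun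
    (fun t _ => ?_) measurableSet_Ioi
  simp only [Pi.add_apply]
  ring


/-- For `b > 0` and `ε > 0`,
`∫_{b(1+ε)}^∞ log t / (b-t)² dt = (1/(bε))(log b + ε log(1 + 1/ε) + log(1+ε))`. -/
theorem integral_log_div_sq_tail (b ε : ℝ) (hb : 0 < b) (hε : 0 < ε) :
    ∫ t in Set.Ioi (b * (1 + ε)), Real.log t / (b - t) ^ 2 =
      (1 / (b * ε)) *
        (Real.log b + ε * Real.log (1 + 1 / ε) + Real.log (1 + ε)) := by
  have hab : b < b * (1 + ε) := by nlinarith [mul_pos hb hε]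
  have hint := MeasureTheory.integral_Ioi_of_hasDerivAt_of_tendsto'
    (fun t ht => hasDerivAt_neg_log_sub_div_add_log_sub_log 0 hb (hab.trans_le ht))
    (by simpa only [sub_zero] using integrableOn_Ioi_log_div_sub_sq hb hab)
    (tendsto_neg_log_sub_div_add_log_sub_log_atTop b 0)
  simp only [sub_zero] at hint
  have hε₁ : 1 + ε ≠ 0 := by positivity
  have hlog : Real.log (1 + 1 / ε) = Real.log (1 + ε) - Real.log ε := by
    rw [← Real.log_div hε₁ hε.ne']
    congr 1
    field_simp
    ring
  rw [hint, hlog, show b * (1 + ε) - b = b * ε by ring, Real.log_mul hb.ne' hε₁,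
    Real.log_mul hb.ne' hε.ne']
  field_simp
  ring
end

section
/- For every real t ≥ 2.206, one has log(t/2) − 2/(1 + 4t²) + 2/(3t) + 1/(8t²) ≤ log t − 0.4629. -/
/-- For `t ≥ 2.206`,
`log(t/2) - 2/(1+4t²) + 2/(3t) + 1/(8t²) ≤ log t - 0.4629`. -/
theorem U0_le_log_sub (t : ℝ) (ht : 2.206 ≤ t) :
    Real.log (t / 2) - 2 / (1 + 4 * t ^ 2) + 2 / (3 * t) + 1 / (8 * t ^ 2) ≤
      Real.log t - 0.4629 := by
  have ht0 : 0 < t := by linarith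
  have hlog2 := Real.log_two_gt_d9
  have hrational :
      2 / (3 * t) + 1 / (8 * t ^ 2) - 2 / (1 + 4 * t ^ 2) ≤ 0.23024 := by
    rw [div_add_div _ _ (by positivity) (by positivity),
      div_sub_div _ _ (by positivity) (by positivity), div_le_iff₀ (by positivity)]
    obtain ⟨s, hs, rfl⟩ : ∃ s : ℝ, 0 ≤ s ∧ t = 2.206 + s :=
      ⟨t - 2.206, by linarith, by ring⟩
    rw [← sub_nonneg]
    ring_nf
    positivity
  rw [Real.log_div ht0.ne' two_ne_zero]
  linarith
end
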